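/- arXiv:2603.28085 — 8 statements merged into one kernel-verified Lean document; each statement's English description precedes it below -/
import Mathlib

section
/- Qubit reduction bound for the effective overlap: let {M_{0|X}, M_{1|X}} and {M_{0|Z}, M_{1|Z}} be binary projective measurements (PVMs) on ℂ^{d_A}, let ψ be a unit vector in ℂ^{d_A} ⊗ ℂ^{d_F}, and set σ_A := tr_F(ψψ†). Define the reflections X := M_{0|X} − M_{1|X} and Z := M_{0|Z} − M_{1|Z}. Let I_A : ℂ^{d_A} → ℂ^{D} be any isometry and let Π_{a|Z}, Π_{b|X} be the dilated measurement operators on ℂ^D given by Π_{a|Z} := I_A M_{a|Z} I_A† for a ≠ a₀ and Π_{a₀|Z} := I_A M_{a₀|Z} I_A† + (1 − I_A I_A†), and analogously for X with distinguished outcome b₀. Set X' := Π_{0|X} − Π_{1|X}, Z' := Π_{0|Z} − Π_{1|Z} and σ'_A := I_A σ_A I_A†. Then c*(σ_A, X, Z) ≤ 1/2 + (1/4)·(tr[σ'_A {X',Z'}²])^{1/2}, where {X',Z'} := X'Z' + Z'X' is the anticommutator. -/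
open scoped Matrix Kronecker ComplexOrder

/-- The operator norm (largest singular value) of a square complex matrix. -/
noncomputable def opNorm {n : Type*} [Fintype n] [DecidableEq n]
    (M : Matrix n n ℂ) : ℝ := ‖Matrix.toEuclideanCLM (𝕜 := ℂ) (n := n) M‖

/-- A POVM: a finite family of positive semidefinite matrices summing to the identity. -/
def IsPOVM {n : Type*} [Fintype n] [DecidableEq n] {ι : Type*} [Fintype ι]
    (E : ι → Matrix n n ℂ) : Prop :=
  (∀ i, (E i).PosSemidef) ∧ ∑ i, E i = 1

/-- The effective overlap `c*(ρ, X, Z)` of a state `ρ` and two POVMs `X`, `Z` on `ℂ^d`. -/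
noncomputable def effOverlap {d : ℕ} {A B : Type} [Fintype A] [DecidableEq A]
    [Fintype B] [DecidableEq B]
    (ρ : Matrix (Fin d) (Fin d) ℂ)
    (X : B → Matrix (Fin d) (Fin d) ℂ) (Z : A → Matrix (Fin d) (Fin d) ℂ) : ℝ :=
  sInf { r : ℝ | ∃ (n : ℕ) (U : Matrix (Fin n) (Fin d) ℂ)
    (PZ : A → Matrix (Fin n) (Fin n) ℂ) (PX : B → Matrix (Fin n) (Fin n) ℂ)
    (κ : ℕ) (P : Fin κ → Matrix (Fin n) (Fin n) ℂ),
    Uᴴ * U = 1 ∧ IsPOVM PZ ∧ IsPOVM PX ∧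
    (∀ k, (P k).IsHermitian ∧ P k * P k = P k) ∧
    (∀ j k, j ≠ k → P j * P k = 0) ∧ (∑ k, P k = 1) ∧
    (∀ a, ∑ k, Uᴴ * (P k * PZ a * P k) * U = Z a) ∧
    (∀ b, ∑ k, Uᴴ * (P k * PX b * P k) * U = X b) ∧
    r = ∑ k, (Matrix.trace (P k * U * ρ * Uᴴ)).re *
      (⨆ b : B, opNorm (∑ a, (P k * PZ a * P k) * (P k * PX b * P k) * (P k * PZ a * P k))) }

/-- Partial trace over the second tensor factor. -/
noncomputable def ptraceRight {dA dF : ℕ} (ρ : Matrix (Fin dA × Fin dF) (Fin dA × Fin dF) ℂ) :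
    Matrix (Fin dA) (Fin dA) ℂ := fun a a' => ∑ f, ρ (a, f) (a', f)

/-- The rank-one outer product `ψψ†` of a vector with itself. -/
noncomputable def outer {ι : Type*} (ψ : ι → ℂ) : Matrix ι ι ℂ :=
  fun i j => ψ i * (starRingEnd ℂ) (ψ j)

open scoped Matrix.Norms.L2Operator in
theorem opNorm_add_smul_le {n : Type*} [Fintype n] [DecidableEq n] {P Z : Matrix n n ℂ}
    (hP : P.IsHermitian) (hPP : P * P = P) (hZ : Z.IsHermitian) (hZZ : Z * Z = 1) (t : ℝ) :
    opNorm ((1 / 2 : ℂ) • P + (t / 4 : ℂ) • (Z * P)) ≤ 1 / 2 + |t| / 4 := by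
  have norm_le_one : ∀ Q : Matrix n n ℂ, star Q * Q = P → ‖Q‖ * ‖Q‖ = ‖P‖ := fun Q hQ => by
    rw [← CStarRing.norm_star_mul_self, hQ]
  have hP' : star P = P := hP
  have hZ' : star Z = Z := hZ
  have h1 := norm_le_one P (by rw [hP', hPP])
  have h2 := norm_le_one (Z * P) (by
    rw [star_mul, hP', hZ', mul_assoc, ← mul_assoc Z, hZZ, one_mul, hPP])
  have h3 : ‖P‖ ≤ 1 := by nlinarith [norm_nonneg P]
  have h4 : ‖Z * P‖ ≤ 1 := by nlinarith [norm_nonneg (Z * P)]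
  change ‖(1 / 2 : ℂ) • P + (t / 4 : ℂ) • (Z * P)‖ ≤ _
  refine (norm_add_le _ _).trans ?_
  rw [norm_smul, norm_smul]
  have h5 : ‖(1 / 2 : ℂ)‖ = 1 / 2 := by norm_num
  have h6 : ‖(t / 4 : ℂ)‖ = |t| / 4 := by simp
  rw [h5, h6]
  have := mul_le_mul_of_nonneg_left h4 (by positivity : 0 ≤ |t| / 4)
  linarith

/-- The spectral projections of a Hermitian matrix, indexed by `Fin d` (some of them may vanish);
each of them commutes with the commutant of the matrix. -/
theorem Matrix.IsHermitian.exists_spectral_projections {d : ℕ} {C : Matrix (Fin d) (Fin d) ℂ}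
    (hC : C.IsHermitian) :
    ∃ (P : Fin d → Matrix (Fin d) (Fin d) ℂ) (μ : Fin d → ℝ),
      (∀ k, (P k).IsHermitian ∧ P k * P k = P k) ∧ (∀ j k, j ≠ k → P j * P k = 0) ∧
      (∑ k, P k = 1) ∧ (∀ k, C * P k = (μ k : ℂ) • P k) ∧
      ∀ Y, Y * C = C * Y → ∀ k, Y * P k = P k * Y := by
  set μ := hC.eigenvalues
  set V : Matrix (Fin d) (Fin d) ℂ := (hC.eigenvectorUnitary : Matrix (Fin d) (Fin d) ℂ)
  have hV1 : Vᴴ * V = 1 := Unitary.coe_star_mul_self hC.eigenvectorUnitary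
  have hV2 : V * Vᴴ = 1 := Unitary.coe_mul_star_self hC.eigenvectorUnitary
  have hCV : C = V * Matrix.diagonal (fun i => (μ i : ℂ)) * Vᴴ := by
    have h := hC.spectral_theorem
    simpa [Unitary.conjStarAlgAut_apply, Function.comp_def, Matrix.star_eq_conjTranspose] using h
  let r : Fin d → Fin d := fun i => Set.rangeSplitting μ ⟨μ i, i, rfl⟩
  have hr : ∀ i, μ (r i) = μ i := fun i => Set.apply_rangeSplitting μ ⟨μ i, i, rfl⟩
  have hr' : ∀ i j, μ i = μ j → r i = r j := fun i j h => by simp only [r, h]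
  let e : Fin d → Matrix (Fin d) (Fin d) ℂ :=
    fun k => Matrix.diagonal fun i => if r i = k then 1 else 0
  have conj_mul : ∀ M N : Matrix (Fin d) (Fin d) ℂ,
      (V * M * Vᴴ) * (V * N * Vᴴ) = V * (M * N) * Vᴴ := fun M N => by
    calc _ = V * M * (Vᴴ * V) * N * Vᴴ := by simp only [Matrix.mul_assoc]
      _ = _ := by rw [hV1]; simp only [Matrix.mul_assoc, Matrix.mul_one]
  refine ⟨fun k => V * e k * Vᴴ, μ, fun k => ⟨?_, ?_⟩, fun j k hjk => ?_, ?_, fun k => ?_,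
    fun Y hY k => ?_⟩
  · refine Matrix.isHermitian_mul_mul_conjTranspose V ?_
    refine Matrix.isHermitian_diagonal_of_self_adjoint _ ?_
    ext i
    by_cases h : r i = k <;> simp [h]
  · simp only [conj_mul, e, Matrix.diagonal_mul_diagonal]
    congr! 4 with i
    by_cases h : r i = k <;> simp [h]
  · simp only [conj_mul, e, Matrix.diagonal_mul_diagonal]
    have : (fun i => (if r i = j then (1 : ℂ) else 0) * if r i = k then 1 else 0) = fun _ => 0 := by
      funext i
      by_cases h : r i = j
      · simp [h, hjk]
      · simp [h]
    rw [this]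
    simp
  · rw [← Finset.sum_mul, ← Finset.mul_sum]
    have : ∑ k, e k = 1 := by
      ext i j
      rw [Matrix.sum_apply]
      by_cases h : i = j
      · subst h; simp [e]
      · simp [e, h]
    rw [this, Matrix.mul_one, hV2]
  · conv_lhs => rw [hCV]
    rw [conj_mul, ← Matrix.smul_mul, ← Matrix.mul_smul]
    congr 2
    ext i j
    by_cases h : i = j
    · subst h
      by_cases h' : r i = k
      · simp [e, h', ← hr i]
      · simp [e, h']
    · simp [e, h]
  · set W := Vᴴ * Y * V with hW
    have hYW : Y = V * W * Vᴴ := by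
      calc Y = (V * Vᴴ) * Y * (V * Vᴴ) := by rw [hV2]; simp
        _ = _ := by simp only [hW, Matrix.mul_assoc]
    have hinj : ∀ M N : Matrix (Fin d) (Fin d) ℂ, V * M * Vᴴ = V * N * Vᴴ → M = N := by
      intro M N h
      have h2 := congrArg (fun T => Vᴴ * T * V) h
      have h3 : ∀ T : Matrix (Fin d) (Fin d) ℂ, Vᴴ * (V * T * Vᴴ) * V = T := fun T => by
        calc _ = (Vᴴ * V) * T * (Vᴴ * V) := by simp only [Matrix.mul_assoc]
          _ = T := by rw [hV1]; simp
      simpa only [h3] using h2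
    have hWD : W * Matrix.diagonal (fun i => (μ i : ℂ)) =
        Matrix.diagonal (fun i => (μ i : ℂ)) * W := by
      apply hinj
      rw [← conj_mul W, ← conj_mul _ W, ← hYW, ← hCV, hY]
    rw [hYW, conj_mul, conj_mul]
    congr 2
    ext i j
    have hij := congrFun (congrFun hWD i) j
    rw [Matrix.mul_diagonal, Matrix.diagonal_mul] at hij
    simp only [e]
    rw [Matrix.mul_diagonal, Matrix.diagonal_mul]
    by_cases h : μ i = μ j
    · rw [hr' i j h, mul_comm]
    · have hne : (μ i : ℂ) ≠ μ j := by exact_mod_cast h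
      have : W i j = 0 := by
        have h0 : W i j * ((μ j : ℂ) - μ i) = 0 := by linear_combination hij
        rcases mul_eq_zero.1 h0 with h0 | h0
        · exact h0
        · exact absurd (sub_eq_zero.1 h0).symm hne
      simp [this]

/-- If the anticommutator of the reflections of two binary measurements acts on the range of `P`
as the scalar `t`, then the overlap of the measurements compressed to that range is at most
`1 / 2 + |t| / 4`. -/
theorem opNorm_overlap_le {n : Type*} [Fintype n] [DecidableEq n] {P : Matrix n n ℂ}
    (hP : P.IsHermitian) (hPP : P * P = P)
    {MX MZ : Fin 2 → Matrix n n ℂ} (hMXsum : ∑ b, MX b = 1)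
    (hMZ : ∀ a, (MZ a).IsHermitian) (hMZsum : ∑ a, MZ a = 1)
    (hZZ : (MZ 0 - MZ 1) * (MZ 0 - MZ 1) = 1)
    (hX : ∀ b, MX b * P = P * MX b) (hZ : ∀ a, MZ a * P = P * MZ a) {t : ℝ}
    (ht : ((MX 0 - MX 1) * (MZ 0 - MZ 1) + (MZ 0 - MZ 1) * (MX 0 - MX 1)) * P = (t : ℂ) • P)
    (b : Fin 2) :
    opNorm (∑ a, (P * MZ a * P) * (P * MX b * P) * (P * MZ a * P)) ≤ 1 / 2 + |t| / 4 := by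
  have compress : ∀ M : Matrix n n ℂ, M * P = P * M → P * M * P = M * P := fun M h => by
    rw [← h, Matrix.mul_assoc, hPP]
  have hprod : ∀ a, (P * MZ a * P) * (P * MX b * P) * (P * MZ a * P)
      = MZ a * MX b * MZ a * P := fun a => by
    rw [compress _ (hZ a), compress _ (hX b)]
    calc MZ a * P * (MX b * P) * (MZ a * P) = MZ a * (P * MX b) * (P * MZ a) * P := by
          simp only [Matrix.mul_assoc]
      _ = MZ a * MX b * (P * P) * MZ a * P := by rw [← hX]; simp only [Matrix.mul_assoc]
      _ = MZ a * MX b * (P * MZ a) * P := by rw [hPP]; simp only [Matrix.mul_assoc]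
      _ = MZ a * MX b * MZ a * (P * P) := by rw [← hZ]; simp only [Matrix.mul_assoc]
      _ = _ := by rw [hPP]
  simp only [hprod]
  rw [Fin.sum_univ_two] at hMXsum hMZsum ⊢
  set X := MX 0 - MX 1 with hXdef
  set Z := MZ 0 - MZ 1 with hZdef
  have hZherm : Z.IsHermitian := (hMZ 0).sub (hMZ 1)
  have hZ0 : MZ 0 = (1 / 2 : ℂ) • (1 + Z) := by rw [← hMZsum, hZdef]; module
  have hZ1 : MZ 1 = (1 / 2 : ℂ) • (1 - Z) := by rw [← hMZsum, hZdef]; module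
  have hX0 : MX 0 = (1 / 2 : ℂ) • (1 + X) := by rw [← hMXsum, hXdef]; module
  have hX1 : MX 1 = (1 / 2 : ℂ) • (1 - X) := by rw [← hMXsum, hXdef]; module
  have key : ∀ s : ℝ, ((1 / 2 : ℂ) • (1 + Z)) * ((1 / 2 : ℂ) • (1 + (s : ℂ) • X)) *
        ((1 / 2 : ℂ) • (1 + Z)) * P +
      ((1 / 2 : ℂ) • (1 - Z)) * ((1 / 2 : ℂ) • (1 + (s : ℂ) • X)) * ((1 / 2 : ℂ) • (1 - Z)) * P =
      (1 / 2 : ℂ) • P + ((s * t : ℝ) / 4 : ℂ) • (Z * P) := fun s => by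
    have h : Z * X * Z + X = Z * (X * Z + Z * X) := by
      rw [Matrix.mul_add, ← Matrix.mul_assoc, ← Matrix.mul_assoc, hZZ, Matrix.one_mul]
    have h' : Z * X * Z * P + X * P = (t : ℂ) • (Z * P) := by
      rw [← Matrix.add_mul, h, Matrix.mul_assoc, ht, Matrix.mul_smul]
    have h'' : Z * X * Z * P = (t : ℂ) • (Z * P) - X * P := eq_sub_of_add_eq h'
    simp only [Matrix.smul_mul, Matrix.mul_smul, Matrix.add_mul, Matrix.mul_add, Matrix.sub_mul,
      Matrix.mul_sub, Matrix.one_mul, Matrix.mul_one, hZZ, h'', smul_add, smul_sub, smul_smul]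
    push_cast
    module
  fin_cases b
  · have := opNorm_add_smul_le hP hPP hZherm hZZ (1 * t)
    rw [← key 1] at this
    simpa [hZ0, hZ1, hX0] using this
  · have := opNorm_add_smul_le hP hPP hZherm hZZ (-1 * t)
    rw [← key (-1)] at this
    simpa [hZ0, hZ1, hX1, ← sub_eq_add_neg] using this

theorem ptraceRight_outer {dA dF : ℕ} (ψ : Fin dA × Fin dF → ℂ) :
    ptraceRight (outer ψ) = Matrix.of (fun a f => ψ (a, f)) *
      (Matrix.of fun a f => ψ (a, f))ᴴ := by
  ext a a'
  simp [ptraceRight, outer, Matrix.mul_apply]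

theorem sub_mul_sub_self_eq_one {R : Type*} [Ring R] {E : Fin 2 → R}
    (hE : ∀ i, E i * E i = E i) (hsum : ∑ i, E i = 1) :
    (E 0 - E 1) * (E 0 - E 1) = 1 := by
  rw [Fin.sum_univ_two] at hsum
  have h1 : E 1 = 1 - E 0 := eq_sub_of_add_eq' hsum
  have h0 := hE 0
  rw [h1]
  simp only [sub_mul, mul_sub, mul_one, one_mul, h0]
  abel

theorem mul_add_mul_comm_of_sq_eq_one {R : Type*} [Ring R] {x z : R} (hx : x * x = 1) :
    x * (x * z + z * x) = (x * z + z * x) * x := by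
  rw [mul_add, add_mul, ← mul_assoc, hx, mul_assoc z, hx, mul_assoc]
  rw [one_mul, mul_one, add_comm]

/-- The difference of a dilated binary measurement is the dilated difference, up to a sign on the
complement of the range of the isometry. -/
theorem exists_sign_dilation {d D : ℕ} (M : Fin 2 → Matrix (Fin d) (Fin d) ℂ)
    (V : Matrix (Fin D) (Fin d) ℂ) (c : Fin 2) (Q : Fin 2 → Matrix (Fin D) (Fin D) ℂ)
    (hQ : ∀ a, Q a = if a = c then V * M a * Vᴴ + (1 - V * Vᴴ) else V * M a * Vᴴ) :
    ∃ s : ℂ, Q 0 - Q 1 = V * (M 0 - M 1) * Vᴴ + s • (1 - V * Vᴴ) := by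
  rw [hQ 0, hQ 1]
  fin_cases c
  · refine ⟨1, ?_⟩
    simp [Matrix.mul_sub, Matrix.sub_mul]
    abel
  · refine ⟨-1, ?_⟩
    simp [Matrix.mul_sub, Matrix.sub_mul]
    abel

/-- A dilated reflection intertwines with the original one. -/
theorem dilation_mul_isometry {d D : ℕ} {V : Matrix (Fin D) (Fin d) ℂ} (hV : Vᴴ * V = 1)
    (X : Matrix (Fin d) (Fin d) ℂ) (s : ℂ) :
    (V * X * Vᴴ + s • (1 - V * Vᴴ)) * V = V * X := by
  rw [Matrix.add_mul, Matrix.smul_mul, Matrix.sub_mul, Matrix.mul_assoc (V * X), hV,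
    Matrix.mul_assoc V Vᴴ, hV]
  simp

theorem effOverlap_le_of_le {d : ℕ} {A B : Type} [Fintype A] [DecidableEq A]
    [Fintype B] [DecidableEq B] {ρ : Matrix (Fin d) (Fin d) ℂ}
    {X : B → Matrix (Fin d) (Fin d) ℂ} {Z : A → Matrix (Fin d) (Fin d) ℂ}
    (hX : IsPOVM X) (hZ : IsPOVM Z) {κ : ℕ} {P : Fin κ → Matrix (Fin d) (Fin d) ℂ}
    (hP : ∀ k, (P k).IsHermitian ∧ P k * P k = P k) (horth : ∀ j k, j ≠ k → P j * P k = 0)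
    (hsum : ∑ k, P k = 1) (hPX : ∀ b k, X b * P k = P k * X b)
    (hPZ : ∀ a k, Z a * P k = P k * Z a) {c : ℝ} (hc : 0 ≤ c)
    (h : ∑ k, (Matrix.trace (P k * ρ)).re *
      (⨆ b : B, opNorm (∑ a, (P k * Z a * P k) * (P k * X b * P k) * (P k * Z a * P k))) ≤ c) :
    effOverlap ρ X Z ≤ c := by
  have pinch : ∀ M : Matrix (Fin d) (Fin d) ℂ, (∀ k, M * P k = P k * M) →
      ∑ k, (1 : Matrix (Fin d) (Fin d) ℂ)ᴴ * (P k * M * P k) * 1 = M := fun M hM => by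
    simp only [Matrix.conjTranspose_one, Matrix.one_mul, Matrix.mul_one, ← hM, Matrix.mul_assoc,
      (hP _).2]
    rw [← Finset.mul_sum, hsum, Matrix.mul_one]
  unfold effOverlap
  set S := { r : ℝ | _ }
  by_cases hS : BddBelow S
  · refine (csInf_le hS ?_).trans h
    refine ⟨d, 1, Z, X, κ, P, by simp, hZ, hX, hP, horth, hsum, fun a => pinch _ (hPZ a),
      fun b => pinch _ (hPX b), by simp⟩
  · rw [Real.sInf_of_not_bddBelow hS]
    exact hc

theorem isPOVM_of_projections {n : Type*} [Fintype n] [DecidableEq n] {ι : Type*} [Fintype ι]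
    {E : ι → Matrix n n ℂ} (hE : ∀ i, (E i).IsHermitian ∧ E i * E i = E i)
    (hsum : ∑ i, E i = 1) : IsPOVM E := by
  refine ⟨fun i => ?_, hsum⟩
  have := Matrix.posSemidef_conjTranspose_mul_self (E i)
  rwa [(hE i).1.eq, (hE i).2] at this

/-- `tr (P σ)` is nonnegative for a projection `P` and `σ = B Bᴴ`. -/
theorem trace_projection_mul_nonneg {m n : Type*} [Fintype m] [Fintype n]
    {P : Matrix m m ℂ} (hP : P.IsHermitian) (hPP : P * P = P) (B : Matrix m n ℂ) :
    0 ≤ (Matrix.trace (P * (B * Bᴴ))).re := by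
  have h : Matrix.trace (P * (B * Bᴴ)) = Matrix.trace ((P * B) * (P * B)ᴴ) := by
    rw [Matrix.conjTranspose_mul, hP.eq, ← Matrix.mul_assoc (P * B), Matrix.trace_mul_comm _ P]
    simp only [← Matrix.mul_assoc, hPP]
  rw [h]
  exact (Complex.nonneg_iff.1 (Matrix.posSemidef_self_mul_conjTranspose (P * B)).trace_nonneg).1

/-- **Qubit reduction bound for the effective overlap.** For binary PVMs on `ℂ^{d_A}`,
a unit vector `ψ ∈ ℂ^{d_A} ⊗ ℂ^{d_F}` with marginal `σ_A`, and any isometric dilation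
`I_A : ℂ^{d_A} → ℂ^D` with dilated measurements `Π` and reflections `X'`, `Z'`,
one has `c*(σ_A, X, Z) ≤ 1/2 + (1/4)·(tr[σ'_A {X',Z'}²])^{1/2}`. -/
theorem qubit_reduction_effective_overlap {dA dF D : ℕ}
    (MX MZ : Fin 2 → Matrix (Fin dA) (Fin dA) ℂ)
    (hMXproj : ∀ b, (MX b).IsHermitian ∧ MX b * MX b = MX b) (hMXsum : ∑ b, MX b = 1)
    (hMZproj : ∀ a, (MZ a).IsHermitian ∧ MZ a * MZ a = MZ a) (hMZsum : ∑ a, MZ a = 1)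
    (ψ : Fin dA × Fin dF → ℂ) (hψ : ∑ i, Complex.normSq (ψ i) = 1)
    (σA : Matrix (Fin dA) (Fin dA) ℂ) (hσA : σA = ptraceRight (outer ψ))
    (IA : Matrix (Fin D) (Fin dA) ℂ) (hIA : IAᴴ * IA = 1)
    (a₀ b₀ : Fin 2)
    (PiZ PiX : Fin 2 → Matrix (Fin D) (Fin D) ℂ)
    (hPiZ : ∀ a, PiZ a = if a = a₀ then IA * MZ a * IAᴴ + (1 - IA * IAᴴ)
      else IA * MZ a * IAᴴ)
    (hPiX : ∀ b, PiX b = if b = b₀ then IA * MX b * IAᴴ + (1 - IA * IAᴴ)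
      else IA * MX b * IAᴴ)
    (X' Z' : Matrix (Fin D) (Fin D) ℂ)
    (hX' : X' = PiX 0 - PiX 1) (hZ' : Z' = PiZ 0 - PiZ 1)
    (σA' : Matrix (Fin D) (Fin D) ℂ) (hσA' : σA' = IA * σA * IAᴴ) :
    effOverlap σA MX MZ ≤ 1 / 2 + (1 / 4) *
      Real.sqrt ((Matrix.trace (σA' * ((X' * Z' + Z' * X') * (X' * Z' + Z' * X')))).re) := by
  set X := MX 0 - MX 1 with hX
  set Z := MZ 0 - MZ 1 with hZ
  set C := X * Z + Z * X with hC
  have hXX : X * X = 1 := sub_mul_sub_self_eq_one (fun b => (hMXproj b).2) hMXsum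
  have hZZ : Z * Z = 1 := sub_mul_sub_self_eq_one (fun a => (hMZproj a).2) hMZsum
  have hCherm : C.IsHermitian := by
    have h1 : Xᴴ = X := (hMXproj 0).1.sub (hMXproj 1).1
    have h2 : Zᴴ = Z := (hMZproj 0).1.sub (hMZproj 1).1
    rw [Matrix.IsHermitian, hC, Matrix.conjTranspose_add, Matrix.conjTranspose_mul,
      Matrix.conjTranspose_mul, h1, h2, add_comm]
  have hXC : X * C = C * X := mul_add_mul_comm_of_sq_eq_one hXX
  have hZC : Z * C = C * Z := by
    rw [hC, add_comm]
    exact mul_add_mul_comm_of_sq_eq_one hZZ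
  have commute_of_diff : ∀ (E : Fin 2 → Matrix (Fin dA) (Fin dA) ℂ)
      (Q : Matrix (Fin dA) (Fin dA) ℂ),
      ∑ i, E i = 1 → (E 0 - E 1) * Q = Q * (E 0 - E 1) → ∀ i, E i * Q = Q * E i := by
    intro E Q hE h i
    rw [Fin.sum_univ_two] at hE
    have h0 : E 0 = (1 / 2 : ℂ) • (1 + (E 0 - E 1)) := by rw [← hE]; module
    have h1 : E 1 = (1 / 2 : ℂ) • (1 - (E 0 - E 1)) := by rw [← hE]; module
    fin_cases i
    · change E 0 * Q = Q * E 0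
      rw [h0, Matrix.smul_mul, Matrix.mul_smul, Matrix.add_mul, Matrix.mul_add, h]
      simp
    · change E 1 * Q = Q * E 1
      rw [h1, Matrix.smul_mul, Matrix.mul_smul, Matrix.sub_mul, Matrix.mul_sub, h]
      simp
  obtain ⟨P, μ, hP, horth, hsum, hCP, hcomm⟩ := hCherm.exists_spectral_projections
  have hPX : ∀ b k, MX b * P k = P k * MX b := fun b k =>
    commute_of_diff MX (P k) hMXsum (hcomm X hXC k) b
  have hPZ : ∀ a k, MZ a * P k = P k * MZ a := fun a k =>
    commute_of_diff MZ (P k) hMZsum (hcomm Z hZC k) a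
  set p : Fin dA → ℝ := fun k => (Matrix.trace (P k * σA)).re with hp
  have hp0 : ∀ k, 0 ≤ p k := fun k => by
    simp only [hp, hσA, ptraceRight_outer]
    exact trace_projection_mul_nonneg (hP k).1 (hP k).2 _
  have hp1 : ∑ k, p k = 1 := by
    rw [hp, ← Complex.re_sum, ← Matrix.trace_sum, ← Finset.sum_mul, hsum, Matrix.one_mul, hσA]
    simp only [Matrix.trace, Matrix.diag_apply, ptraceRight, outer, Complex.mul_conj]
    rw [← Fintype.sum_prod_type' (fun a f => (Complex.normSq (ψ (a, f)) : ℂ))]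
    rw [← Complex.ofReal_sum, Complex.ofReal_re]
    exact hψ
  have htrC : (Matrix.trace (σA * (C * C))).re = ∑ k, p k * μ k ^ 2 := by
    have hCC : C * C = ∑ k, ((μ k ^ 2 : ℝ) : ℂ) • P k := by
      calc C * C = ∑ k, C * (C * P k) := by
            rw [← Finset.mul_sum, ← Finset.mul_sum, hsum, Matrix.mul_one]
        _ = _ := by
            refine Finset.sum_congr rfl fun k _ => ?_
            rw [hCP, Matrix.mul_smul, hCP, smul_smul, sq, Complex.ofReal_mul]
    rw [hCC, Finset.mul_sum, Matrix.trace_sum, Complex.re_sum]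
    refine Finset.sum_congr rfl fun k _ => ?_
    rw [Matrix.mul_smul, Matrix.trace_smul, smul_eq_mul, Complex.re_ofReal_mul, mul_comm,
      Matrix.trace_mul_comm]
  have htr : Matrix.trace (σA' * ((X' * Z' + Z' * X') * (X' * Z' + Z' * X'))) =
      Matrix.trace (σA * (C * C)) := by
    obtain ⟨s, hs⟩ := exists_sign_dilation MX IA b₀ PiX hPiX
    obtain ⟨u, hu⟩ := exists_sign_dilation MZ IA a₀ PiZ hPiZ
    have hXI : X' * IA = IA * X := by rw [hX', hs, dilation_mul_isometry hIA]
    have hZI : Z' * IA = IA * Z := by rw [hZ', hu, dilation_mul_isometry hIA]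
    have hCI : (X' * Z' + Z' * X') * IA = IA * C := by
      rw [Matrix.add_mul, Matrix.mul_assoc, Matrix.mul_assoc, hXI, hZI, ← Matrix.mul_assoc,
        ← Matrix.mul_assoc, hXI, hZI, hC, Matrix.mul_add, Matrix.mul_assoc, Matrix.mul_assoc]
    rw [hσA', Matrix.trace_mul_comm, ← Matrix.mul_assoc, Matrix.trace_mul_comm, ← Matrix.mul_assoc]
    set C' := X' * Z' + Z' * X'
    have : C' * C' * IA = IA * (C * C) := by
      rw [Matrix.mul_assoc, hCI, ← Matrix.mul_assoc, hCI, Matrix.mul_assoc]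
    rw [Matrix.mul_assoc IAᴴ, ← Matrix.mul_assoc _ IA, this, ← Matrix.mul_assoc, ← Matrix.mul_assoc,
      hIA, Matrix.one_mul, Matrix.trace_mul_comm]
  rw [htr, htrC]
  refine effOverlap_le_of_le (isPOVM_of_projections hMXproj hMXsum)
    (isPOVM_of_projections hMZproj hMZsum) hP horth hsum hPX hPZ (by positivity) ?_
  have hCS : ∑ k, p k * |μ k| ≤ Real.sqrt (∑ k, p k * μ k ^ 2) := by
    refine Real.le_sqrt_of_sq_le ?_
    have := Real.pow_arith_mean_le_arith_mean_pow Finset.univ p (fun k => |μ k|)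
      (fun k _ => hp0 k) hp1 (fun k _ => abs_nonneg _) 2
    simpa only [sq_abs] using this
  calc _ ≤ ∑ k, p k * (1 / 2 + |μ k| / 4) :=
        Finset.sum_le_sum fun k _ => mul_le_mul_of_nonneg_left
          (ciSup_le fun b => opNorm_overlap_le (hP k).1 (hP k).2 hMXsum (fun a => (hMZproj a).1)
            hMZsum hZZ (fun b => hPX b k) (fun a => hPZ a k) (hCP k) b) (hp0 k)
    _ = 1 / 2 + (1 / 4) * ∑ k, p k * |μ k| := by
        simp only [mul_add, Finset.sum_add_distrib, ← Finset.sum_mul, hp1, Finset.mul_sum]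
        rw [one_mul]
        congr 1
        exact Finset.sum_congr rfl fun k _ => by ring
    _ ≤ _ := by linarith
end

section
/- Equivalence of separability and joint measurability at the level of behaviors: let q(a,b|x,y) be a family of real numbers indexed by finite sets of outcomes a ∈ A, b ∈ B and inputs x ∈ X, y ∈ Y. Then the following are equivalent. (1) There exist finite dimensions d_A, d_B, POVMs {M_{a|x}}_a on ℂ^{d_A} and {N_{b|y}}_b on ℂ^{d_B} for each input, a finite index set I, a probability distribution (p_i)_{i∈I}, and density matrices α_i on ℂ^{d_A} and β_i on ℂ^{d_B}, such that q(a,b|x,y) = Σ_i p_i · tr[α_i M_{a|x}] · tr[β_i N_{b|y}] for all a,b,x,y (i.e. q arises from a separable state). (2) There exist finite dimensions d_A, d_B, POVMs {M_{a|x}}_a on ℂ^{d_A}, a density matrix ρ on ℂ^{d_A} ⊗ ℂ^{d_B}, a finite index set Λ, a POVM {G_λ}_{λ∈Λ} on ℂ^{d_B}, and numbers p(b|y,λ) ≥ 0 with Σ_b p(b|y,λ) = 1 for all y, λ, such that q(a,b|x,y) = Σ_λ p(b|y,λ) · tr[ρ (M_{a|x} ⊗ G_λ)] for all a,b,x,y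 (i.e. Bob's measurements are jointly measurable via the parent POVM {G_λ}). -/
open scoped Matrix Kronecker ComplexOrder

open Matrix

namespace Matrix

variable {m n ι : Type*} [Fintype n]

theorem PosSemidef.exists_eq_conjTranspose_mul_self {P : Matrix n n ℂ} (hP : P.PosSemidef) :
    ∃ C : Matrix n n ℂ, P = Cᴴ * C := by
  classical
  open scoped MatrixOrder in
  exact CStarAlgebra.nonneg_iff_eq_star_mul_self.mp hP.nonneg

theorem PosSemidef.trace_mul_nonneg {P Q : Matrix n n ℂ} (hP : P.PosSemidef)
    (hQ : Q.PosSemidef) : 0 ≤ (P * Q).trace := by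
  obtain ⟨C, rfl⟩ := hP.exists_eq_conjTranspose_mul_self
  rw [Matrix.mul_assoc, trace_mul_comm]
  exact (hQ.mul_mul_conjTranspose_same C).trace_nonneg

/-- The unnormalized state `tr₂[ρ (1 ⊗ G)]` on the first factor, conditioned on the effect `G`
on the second factor. -/
def conditionalState (ρ : Matrix (m × n) (m × n) ℂ) (G : Matrix n n ℂ) : Matrix m m ℂ :=
  of fun i j => ∑ k, ∑ l, ρ (i, k) (j, l) * G l k

theorem trace_conditionalState_mul [Fintype m] (ρ : Matrix (m × n) (m × n) ℂ) (G : Matrix n n ℂ)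
    (M : Matrix m m ℂ) : (conditionalState ρ G * M).trace = (ρ * (M ⊗ₖ G)).trace := by
  simp only [trace, diag_apply, mul_apply, conditionalState, of_apply, kroneckerMap_apply,
    Fintype.sum_prod_type, Finset.sum_mul]
  refine Finset.sum_congr rfl fun i _ => ?_
  rw [Finset.sum_comm]
  refine Finset.sum_congr rfl fun k _ => Finset.sum_congr rfl fun j _ =>
    Finset.sum_congr rfl fun l _ => ?_
  ring

theorem conditionalState_sum [Fintype ι] (ρ : Matrix (m × n) (m × n) ℂ)
    (G : ι → Matrix n n ℂ) : conditionalState ρ (∑ l, G l) = ∑ l, conditionalState ρ (G l) := by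
  ext i j
  simp only [conditionalState, of_apply, sum_apply, Finset.mul_sum]
  rw [Finset.sum_comm]
  simp_rw [Finset.sum_comm (s := (Finset.univ : Finset ι))]
  exact Finset.sum_comm

theorem trace_conditionalState_one [Fintype m] [DecidableEq n] (ρ : Matrix (m × n) (m × n) ℂ) :
    (conditionalState ρ 1).trace = ρ.trace := by
  simp [trace, conditionalState, one_apply, Fintype.sum_prod_type]

theorem PosSemidef.conditionalState [Fintype m] {ρ : Matrix (m × n) (m × n) ℂ} {G : Matrix n n ℂ}
    (hρ : ρ.PosSemidef) (hG : G.PosSemidef) : (conditionalState ρ G).PosSemidef := by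
  classical
  obtain ⟨C, rfl⟩ := hG.exists_eq_conjTranspose_mul_self
  let W (r : n) : Matrix (m × n) m ℂ := of fun jl i => if jl.1 = i then star (C r jl.2) else 0
  have h : Matrix.conditionalState ρ (Cᴴ * C) = ∑ r, (W r)ᴴ * ρ * W r := by
    ext i j
    simp only [Matrix.conditionalState, of_apply, sum_apply, mul_apply, conjTranspose_apply, W,
      Fintype.sum_prod_type, Finset.sum_mul, Finset.mul_sum, apply_ite star, star_star, star_zero,
      ite_mul, mul_ite, zero_mul, mul_zero, Finset.sum_ite_irrel, Finset.sum_const_zero,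
      Finset.sum_ite_eq', Finset.mem_univ, if_true]
    calc
      _ = ∑ k, ∑ r, ∑ l, C r k * ρ (i, k) (j, l) * star (C r l) :=
        Finset.sum_congr rfl fun k _ => Finset.sum_comm.trans <|
          Finset.sum_congr rfl fun r _ => Finset.sum_congr rfl fun l _ => by ring
      _ = _ := Finset.sum_comm.trans <| Finset.sum_congr rfl fun r _ => Finset.sum_comm
  rw [h]
  exact posSemidef_sum _ fun r _ => hρ.conjTranspose_mul_mul_same (W r)

theorem PosSemidef.coe_re_trace {T : Matrix n n ℂ} (hT : T.PosSemidef) :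
    (T.trace.re : ℂ) = T.trace :=
  (Complex.eq_re_of_ofReal_le hT.trace_nonneg).symm

theorem PosSemidef.exists_state_smul_eq {T σ : Matrix n n ℂ} (hT : T.PosSemidef)
    (hσ : σ.PosSemidef) (hσ1 : σ.trace = 1) :
    ∃ α : Matrix n n ℂ, (α.PosSemidef ∧ α.trace = 1) ∧ T = T.trace • α := by
  by_cases h : T.trace = 0
  · exact ⟨σ, ⟨hσ, hσ1⟩, by rw [h, zero_smul, hT.trace_eq_zero_iff.mp h]⟩
  · refine ⟨T.trace⁻¹ • T, ⟨hT.smul (inv_nonneg.mpr hT.trace_nonneg), ?_⟩, ?_⟩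
    · rw [trace_smul, smul_eq_mul, inv_mul_cancel₀ h]
    · rw [smul_inv_smul₀ h]

theorem trace_diagonal_single_mul_diagonal [DecidableEq n] (i : n) (d : n → ℂ) :
    (diagonal (Pi.single i 1) * diagonal d).trace = d i := by
  simp [Pi.single_apply]

theorem posSemidef_diagonal_single {n : Type*} [DecidableEq n] (i : n) :
    (diagonal (Pi.single i 1) : Matrix n n ℂ).PosSemidef :=
  PosSemidef.diagonal (Pi.single_nonneg.mpr zero_le_one)

end Matrix

theorem isPOVM_diagonal_single {n : Type*} [Fintype n] [DecidableEq n] :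
    IsPOVM fun i : n => (diagonal (Pi.single i 1) : Matrix n n ℂ) := by
  refine ⟨posSemidef_diagonal_single, ?_⟩
  ext i j
  simp [Matrix.sum_apply, diagonal_apply, one_apply, Pi.single_apply]

theorem isPOVM_diagonal_ofReal {n ι : Type*} [Fintype n] [DecidableEq n] [Fintype ι]
    {p : ι → n → ℝ} (hp : ∀ b l, 0 ≤ p b l) (hp1 : ∀ l, ∑ b, p b l = 1) :
    IsPOVM fun b => diagonal fun l => (p b l : ℂ) := by
  refine ⟨fun b => PosSemidef.diagonal fun l => Complex.zero_le_real.mpr (hp b l), ?_⟩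
  ext i j
  rcases eq_or_ne i j with rfl | hij
  · simp [Matrix.sum_apply, ← Complex.ofReal_sum, hp1]
  · simp [Matrix.sum_apply, hij]

/-- **Equivalence of separability and joint measurability at the level of behaviors.**
A behavior `q(a,b|x,y)` arises from local measurements on a separable state if and only
if it arises from measurements `{M_{a|x}}` on Alice's side of a bipartite state together
with a parent POVM `{G_λ}` on Bob's side and response distributions `p(b|y,λ)`. -/
theorem separable_iff_jointly_measurable
    {A B X Y : Type} [Fintype A] [DecidableEq A] [Fintype B] [DecidableEq B]
    [Fintype X] [Fintype Y]
    (q : A → B → X → Y → ℝ) :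
    (∃ (dA dB m : ℕ)
      (M : X → A → Matrix (Fin dA) (Fin dA) ℂ)
      (N : Y → B → Matrix (Fin dB) (Fin dB) ℂ)
      (p : Fin m → ℝ)
      (α : Fin m → Matrix (Fin dA) (Fin dA) ℂ)
      (β : Fin m → Matrix (Fin dB) (Fin dB) ℂ),
      (∀ x, IsPOVM (M x)) ∧ (∀ y, IsPOVM (N y)) ∧
      (∀ i, 0 ≤ p i) ∧ (∑ i, p i = 1) ∧
      (∀ i, (α i).PosSemidef ∧ (α i).trace = 1) ∧
      (∀ i, (β i).PosSemidef ∧ (β i).trace = 1) ∧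
      (∀ a b x y, q a b x y =
        ∑ i, p i * (Matrix.trace (α i * M x a)).re * (Matrix.trace (β i * N y b)).re))
    ↔
    (∃ (dA dB m : ℕ)
      (M : X → A → Matrix (Fin dA) (Fin dA) ℂ)
      (ρ : Matrix ((Fin dA) × (Fin dB)) ((Fin dA) × (Fin dB)) ℂ)
      (G : Fin m → Matrix (Fin dB) (Fin dB) ℂ)
      (p : B → Y → Fin m → ℝ),
      (∀ x, IsPOVM (M x)) ∧ ρ.PosSemidef ∧ ρ.trace = 1 ∧ IsPOVM G ∧
      (∀ b y l, 0 ≤ p b y l) ∧ (∀ y l, ∑ b, p b y l = 1) ∧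
      (∀ a b x y, q a b x y =
        ∑ l, p b y l * (Matrix.trace (ρ * (M x a ⊗ₖ G l))).re)) := by
  constructor
  · rintro ⟨dA, dB, m, M, N, p, α, β, hM, hN, hp, hp1, hα, hβ, hq⟩
    refine ⟨dA, m, m, M, ∑ i, (p i : ℂ) • (α i ⊗ₖ diagonal (Pi.single i 1)),
      fun i => diagonal (Pi.single i 1), fun b y i => (β i * N y b).trace.re, hM, ?_, ?_,
      isPOVM_diagonal_single, ?_, ?_, ?_⟩
    · exact posSemidef_sum _ fun i _ =>
        ((hα i).1.kronecker (posSemidef_diagonal_single i)).smul (Complex.zero_le_real.mpr (hp i))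
    · simp [trace_sum, trace_smul, trace_kronecker, hα, ← Complex.ofReal_sum, hp1]
    · exact fun b y i =>
        (Complex.nonneg_iff.mp ((hβ i).1.trace_mul_nonneg ((hN y).1 b))).1
    · intro y i
      rw [← Complex.re_sum, ← trace_sum, ← Matrix.mul_sum, (hN y).2, Matrix.mul_one, (hβ i).2,
        Complex.one_re]
    · intro a b x y
      rw [hq]
      refine Finset.sum_congr rfl fun l _ => ?_
      have h : ((∑ i, (p i : ℂ) • (α i ⊗ₖ diagonal (Pi.single i 1))) *
          (M x a ⊗ₖ diagonal (Pi.single l 1))).trace = p l * (α l * M x a).trace := by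
        simp_rw [Finset.sum_mul, trace_sum, smul_mul_assoc, trace_smul, ← mul_kronecker_mul,
          trace_kronecker, trace_diagonal_single_mul_diagonal]
        simp [Pi.single_apply]
      rw [h, Complex.re_ofReal_mul, mul_comm]
  · rintro ⟨dA, dB, m, M, ρ, G, p, hM, hρ, hρ1, hG, hp, hp1, hq⟩
    have hT (l : Fin m) := hρ.conditionalState (hG.1 l)
    choose α hα hTα using fun l => (hT l).exists_state_smul_eq (hρ.conditionalState .one)
      ((trace_conditionalState_one ρ).trans hρ1)
    refine ⟨dA, m, m, M, fun y b => diagonal fun l => (p b y l : ℂ),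
      fun l => (conditionalState ρ (G l)).trace.re, α, fun l => diagonal (Pi.single l 1), hM,
      fun y => isPOVM_diagonal_ofReal (fun b => hp b y) (hp1 y),
      fun l => (Complex.nonneg_iff.mp (hT l).trace_nonneg).1, ?_, hα, fun l =>
      ⟨posSemidef_diagonal_single l, by simp⟩, ?_⟩
    · rw [← Complex.re_sum, ← trace_sum, ← conditionalState_sum, hG.2, trace_conditionalState_one,
        hρ1, Complex.one_re]
    · intro a b x y
      rw [hq]
      refine Finset.sum_congr rfl fun l _ => ?_
      have h : (conditionalState ρ (G l) * M x a).trace =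
          (conditionalState ρ (G l)).trace.re * (α l * M x a).trace := by
        conv_lhs => rw [hTα l, Matrix.smul_mul, trace_smul, smul_eq_mul]
        rw [(hT l).coe_re_trace]
      rw [← trace_conditionalState_mul, h, trace_diagonal_single_mul_diagonal,
        Complex.re_ofReal_mul, Complex.ofReal_re, mul_comm]
end

section
/- Monotonicity of the effective overlap under isometric dilation of the measurements: let {M_{0|X}, M_{1|X}} and {M_{0|Z}, M_{1|Z}} be binary PVMs on ℂ^{d_A}, let σ be a density matrix on ℂ^{d_A}, and let I : ℂ^{d_A} → ℂ^{D} be an isometry. Define the dilated POVMs on ℂ^D by Π_{a|Z} := I M_{a|Z} I† for a ≠ a₀, Π_{a₀|Z} := I M_{a₀|Z} I† + (1 − I I†), and analogously Π_{b|X} with distinguished outcome b₀. Then the dilated families X' = {Π_{b|X}} and Z' = {Π_{a|Z}} are PVMs on ℂ^D satisfying I† Π_{a|Z} I = M_{a|Z} and I† Π_{b|X} I = M_{b|X}, and the effective overlaps satisfy c*(σ, X, Z) ≤ c*(I σ I†, X', Z'). -/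
open scoped Matrix Kronecker ComplexOrder

/-- An orthogonal projection matrix is positive semidefinite. -/
theorem Matrix.posSemidef_of_isHermitian_of_mul_self {n : Type*} [Fintype n]
    {P : Matrix n n ℂ} (hP : P.IsHermitian) (hPP : P * P = P) : P.PosSemidef := by
  have h := Matrix.posSemidef_conjTranspose_mul_self P
  rwa [hP.eq, hPP] at h

/-- The Born probability of a projection in an isometrically embedded state is nonnegative. -/
theorem Matrix.re_trace_proj_mul_conj_nonneg {n m : Type*} [Fintype n] [Fintype m]
    {P : Matrix n n ℂ} (hP : P.IsHermitian) (hPP : P * P = P) {σ : Matrix m m ℂ}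
    (hσ : σ.PosSemidef) (U : Matrix n m ℂ) :
    0 ≤ (Matrix.trace (P * U * σ * Uᴴ)).re := by
  have h := (hσ.mul_mul_conjTranspose_same (P * U)).trace_nonneg
  have e : Matrix.trace (P * U * σ * (P * U)ᴴ) = Matrix.trace (P * U * σ * Uᴴ) := by
    rw [Matrix.conjTranspose_mul, hP.eq, ← Matrix.mul_assoc, Matrix.trace_mul_comm]
    simp only [← Matrix.mul_assoc, hPP]
  rw [e] at h
  exact (Complex.le_def.mp h).1

/-- Dilating a PVM along an isometry, with the complement of the range assigned to one
distinguished outcome, gives a PVM which compresses back to the original one. -/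
theorem isometric_dilation_pvm {d D : ℕ} {A : Type} [Fintype A] [DecidableEq A]
    {M : A → Matrix (Fin d) (Fin d) ℂ}
    (hM : ∀ a, (M a).IsHermitian ∧ M a * M a = M a) (hMsum : ∑ a, M a = 1)
    {I : Matrix (Fin D) (Fin d) ℂ} (hI : Iᴴ * I = 1) (a₀ : A)
    {N : A → Matrix (Fin D) (Fin D) ℂ}
    (hN : ∀ a, N a = if a = a₀ then I * M a * Iᴴ + (1 - I * Iᴴ) else I * M a * Iᴴ) :
    ((∀ a, (N a).IsHermitian ∧ N a * N a = N a) ∧ ∑ a, N a = 1) ∧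
    (∀ a, Iᴴ * N a * I = M a) := by
  have hI' : ∀ B : Matrix (Fin d) (Fin D) ℂ, Iᴴ * (I * B) = B := fun B => by
    rw [← Matrix.mul_assoc, hI, Matrix.one_mul]
  have hI₂ : ∀ B : Matrix (Fin d) (Fin d) ℂ, Iᴴ * (I * B) = B := fun B => by
    rw [← Matrix.mul_assoc, hI, Matrix.one_mul]
  have hMM : ∀ a (B : Matrix (Fin d) (Fin D) ℂ), M a * (M a * B) = M a * B := fun a B => by
    rw [← Matrix.mul_assoc, (hM a).2]
  have hherm : ∀ a, (I * M a * Iᴴ).IsHermitian := fun a =>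
    Matrix.isHermitian_mul_mul_conjTranspose I (hM a).1
  have hcompl : (1 - I * Iᴴ).IsHermitian :=
    Matrix.isHermitian_one.sub (Matrix.isHermitian_mul_conjTranspose_self I)
  refine ⟨⟨fun a => ⟨?_, ?_⟩, ?_⟩, fun a => ?_⟩
  · rw [hN]
    split_ifs
    · exact (hherm a).add hcompl
    · exact hherm a
  · rw [hN]
    split_ifs
    · simp [Matrix.mul_add, Matrix.add_mul, Matrix.mul_sub, Matrix.sub_mul, Matrix.mul_assoc,
        hI', hMM]
    · simp [Matrix.mul_assoc, hI', hMM]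
  · have h : ∀ a, N a = I * M a * Iᴴ + if a = a₀ then 1 - I * Iᴴ else 0 := fun a => by
      rw [hN]
      split_ifs <;> simp
    simp_rw [h]
    rw [Finset.sum_add_distrib, ← Matrix.sum_mul, ← Matrix.mul_sum, hMsum]
    simp
  · rw [hN]
    split_ifs
    · simp [Matrix.mul_add, Matrix.add_mul, Matrix.mul_sub, Matrix.sub_mul, Matrix.mul_assoc,
        hI, hI₂]
    · simp [Matrix.mul_assoc, hI, hI₂]

/-- The effective overlap does not increase when the state and measurements are pulled back
along an isometry. -/
theorem effOverlap_le_of_isometry {d D : ℕ} {A B : Type} [Fintype A] [DecidableEq A]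
    [Fintype B] [DecidableEq B] {σ : Matrix (Fin d) (Fin d) ℂ} (hσ : σ.PosSemidef)
    {I : Matrix (Fin D) (Fin d) ℂ} (hI : Iᴴ * I = 1)
    {X' : B → Matrix (Fin D) (Fin D) ℂ} {Z' : A → Matrix (Fin D) (Fin D) ℂ}
    (hX' : IsPOVM X') (hZ' : IsPOVM Z')
    {X : B → Matrix (Fin d) (Fin d) ℂ} {Z : A → Matrix (Fin d) (Fin d) ℂ}
    (hX : ∀ b, Iᴴ * X' b * I = X b) (hZ : ∀ a, Iᴴ * Z' a * I = Z a) :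
    effOverlap σ X Z ≤ effOverlap (I * σ * Iᴴ) X' Z' := by
  unfold effOverlap
  refine csInf_le_csInf ⟨0, ?_⟩ ?_ ?_
  · rintro r ⟨n, U, PZ, PX, κ, P, -, -, -, hP, -, -, -, -, rfl⟩
    exact Finset.sum_nonneg fun k _ => mul_nonneg
      (Matrix.re_trace_proj_mul_conj_nonneg (hP k).1 (hP k).2 hσ U)
      (Real.iSup_nonneg fun _ => norm_nonneg _)
  · exact ⟨_, D, 1, Z', X', 1, fun _ => 1, by simp, hZ', hX',
      fun _ => ⟨Matrix.isHermitian_one, by simp⟩,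
      fun j k h => absurd (Subsingleton.elim j k) h, by simp, by simp, by simp, rfl⟩
  · rintro r ⟨n, U, PZ, PX, κ, P, hU, hPZ, hPX, hP, horth, hsum, hcZ, hcX, rfl⟩
    have hpull : ∀ Q : Fin κ → Matrix (Fin n) (Fin n) ℂ,
        ∑ k, (U * I)ᴴ * Q k * (U * I) = Iᴴ * (∑ k, Uᴴ * Q k * U) * I := fun Q => by
      simp only [Matrix.mul_sum, Matrix.sum_mul, Matrix.conjTranspose_mul, Matrix.mul_assoc]
    refine ⟨n, U * I, PZ, PX, κ, P, ?_, hPZ, hPX, hP, horth, hsum, fun a => ?_, fun b => ?_, ?_⟩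
    · rw [Matrix.conjTranspose_mul, Matrix.mul_assoc, ← Matrix.mul_assoc Uᴴ, hU, Matrix.one_mul,
        hI]
    · rw [hpull, hcZ, hZ]
    · rw [hpull, hcX, hX]
    · simp only [Matrix.conjTranspose_mul, Matrix.mul_assoc]

/-- **Monotonicity of the effective overlap under isometric dilation of the measurements.**
The dilated families are PVMs compressing back to the originals, and
`c*(σ, X, Z) ≤ c*(I σ I†, X', Z')`. -/
theorem effOverlap_mono_isometric_dilation {dA D : ℕ}
    (MX MZ : Fin 2 → Matrix (Fin dA) (Fin dA) ℂ)
    (hMXproj : ∀ b, (MX b).IsHermitian ∧ MX b * MX b = MX b) (hMXsum : ∑ b, MX b = 1)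
    (hMZproj : ∀ a, (MZ a).IsHermitian ∧ MZ a * MZ a = MZ a) (hMZsum : ∑ a, MZ a = 1)
    (σ : Matrix (Fin dA) (Fin dA) ℂ) (hσ : σ.PosSemidef) (hσtr : σ.trace = 1)
    (I : Matrix (Fin D) (Fin dA) ℂ) (hI : Iᴴ * I = 1)
    (a₀ b₀ : Fin 2)
    (PiZ PiX : Fin 2 → Matrix (Fin D) (Fin D) ℂ)
    (hPiZ : ∀ a, PiZ a = if a = a₀ then I * MZ a * Iᴴ + (1 - I * Iᴴ)
      else I * MZ a * Iᴴ)
    (hPiX : ∀ b, PiX b = if b = b₀ then I * MX b * Iᴴ + (1 - I * Iᴴ)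
      else I * MX b * Iᴴ) :
    ((∀ a, (PiZ a).IsHermitian ∧ PiZ a * PiZ a = PiZ a) ∧ ∑ a, PiZ a = 1) ∧
    ((∀ b, (PiX b).IsHermitian ∧ PiX b * PiX b = PiX b) ∧ ∑ b, PiX b = 1) ∧
    (∀ a, Iᴴ * PiZ a * I = MZ a) ∧ (∀ b, Iᴴ * PiX b * I = MX b) ∧
    effOverlap σ MX MZ ≤ effOverlap (I * σ * Iᴴ) PiX PiZ := by
  obtain ⟨hZ, hZc⟩ := isometric_dilation_pvm hMZproj hMZsum hI a₀ hPiZ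
  obtain ⟨hX, hXc⟩ := isometric_dilation_pvm hMXproj hMXsum hI b₀ hPiX
  refine ⟨hZ, hX, hZc, hXc, effOverlap_le_of_isometry hσ hI ?_ ?_ hXc hZc⟩
  · exact ⟨fun b => Matrix.posSemidef_of_isHermitian_of_mul_self (hX.1 b).1 (hX.1 b).2, hX.2⟩
  · exact ⟨fun a => Matrix.posSemidef_of_isHermitian_of_mul_self (hZ.1 a).1 (hZ.1 a).2, hZ.2⟩
end

section
/- Sum-of-squares decomposition of the CHSH game polynomial: let A₀, A₁ be self-adjoint d_A×d_A complex matrices with A₀² = A₁² = 1, and let B₀, B₁ be self-adjoint d_B×d_B complex matrices with B₀² = B₁² = 1. Define the CHSH operator Φ := (1/2)·1 + (1/8)(A₀⊗B₀ + A₀⊗B₁ + A₁⊗B₀ − A₁⊗B₁) on ℂ^{d_A}⊗ℂ^{d_B} (Kronecker products). Then (1/2 + 1/(2√2))·1 − Φ = (1/(8√2))·[ (A₀⊗1 − 1⊗(B₀+B₁)/√2)² + (A₁⊗1 − 1⊗(B₀−B₁)/√2)² ]. -/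
open scoped Matrix Kronecker

/-- The square of `X ⊗ 1 - 1 ⊗ Y`; its two cross terms coincide. -/
theorem kronecker_one_sub_one_kronecker_mul_self {R m n : Type*} [CommRing R]
    [Fintype m] [DecidableEq m] [Fintype n] [DecidableEq n]
    (X : Matrix m m R) (Y : Matrix n n R) :
    (X ⊗ₖ (1 : Matrix n n R) - (1 : Matrix m m R) ⊗ₖ Y) *
        (X ⊗ₖ (1 : Matrix n n R) - (1 : Matrix m m R) ⊗ₖ Y) =
      (X * X) ⊗ₖ (1 : Matrix n n R) + (1 : Matrix m m R) ⊗ₖ (Y * Y) - (2 : R) • X ⊗ₖ Y := by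
  simp only [sub_mul, mul_sub, ← Matrix.mul_kronecker_mul, one_mul, mul_one]
  module

/-- **Sum-of-squares decomposition of the CHSH game polynomial.** For binary observables
`A₀, A₁` and `B₀, B₁`, with `Φ = ½·1 + ⅛(A₀⊗B₀ + A₀⊗B₁ + A₁⊗B₀ − A₁⊗B₁)`,
one has `(½ + 1/(2√2))·1 − Φ = (1/(8√2))·[(A₀⊗1 − 1⊗(B₀+B₁)/√2)² + (A₁⊗1 − 1⊗(B₀−B₁)/√2)²]`. -/
theorem chsh_sos_decomposition {dA dB : ℕ}
    (A0 A1 : Matrix (Fin dA) (Fin dA) ℂ) (B0 B1 : Matrix (Fin dB) (Fin dB) ℂ)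
    (hA0 : A0.IsHermitian) (hA1 : A1.IsHermitian)
    (hB0 : B0.IsHermitian) (hB1 : B1.IsHermitian)
    (hA0sq : A0 * A0 = 1) (hA1sq : A1 * A1 = 1)
    (hB0sq : B0 * B0 = 1) (hB1sq : B1 * B1 = 1)
    (Φ : Matrix (Fin dA × Fin dB) (Fin dA × Fin dB) ℂ)
    (hΦ : Φ = (1 / 2 : ℂ) • (1 : Matrix (Fin dA × Fin dB) (Fin dA × Fin dB) ℂ) +
      (1 / 8 : ℂ) • (A0 ⊗ₖ B0 + A0 ⊗ₖ B1 + A1 ⊗ₖ B0 - A1 ⊗ₖ B1))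
    (S0 S1 : Matrix (Fin dA × Fin dB) (Fin dA × Fin dB) ℂ)
    (hS0 : S0 = A0 ⊗ₖ (1 : Matrix (Fin dB) (Fin dB) ℂ) -
      (1 : Matrix (Fin dA) (Fin dA) ℂ) ⊗ₖ (((Real.sqrt 2 : ℝ) : ℂ)⁻¹ • (B0 + B1)))
    (hS1 : S1 = A1 ⊗ₖ (1 : Matrix (Fin dB) (Fin dB) ℂ) -
      (1 : Matrix (Fin dA) (Fin dA) ℂ) ⊗ₖ (((Real.sqrt 2 : ℝ) : ℂ)⁻¹ • (B0 - B1))) :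
    ((1 / 2 + 1 / (2 * Real.sqrt 2) : ℝ) : ℂ) •
        (1 : Matrix (Fin dA × Fin dB) (Fin dA × Fin dB) ℂ) - Φ =
      ((1 / (8 * Real.sqrt 2) : ℝ) : ℂ) • (S0 * S0 + S1 * S1) := by
  have add_mul_self_add_sub_mul_self :
      (B0 + B1) * (B0 + B1) + (B0 - B1) * (B0 - B1) = (4 : ℂ) • 1 := by
    simp only [add_mul, mul_add, sub_mul, mul_sub, hB0sq, hB1sq]
    module
  have sqrt_two_ne_zero : ((Real.sqrt 2 : ℝ) : ℂ) ≠ 0 := by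
    exact_mod_cast (Real.sqrt_pos.mpr two_pos).ne'
  have sqrt_two_sq : ((Real.sqrt 2 : ℝ) : ℂ) ^ 2 = 2 := by
    exact_mod_cast Real.sq_sqrt (zero_le_two (α := ℝ))
  have sum_squares : S0 * S0 + S1 * S1 = (4 : ℂ) • 1 - (2 * ((Real.sqrt 2 : ℝ) : ℂ)⁻¹) •
      (A0 ⊗ₖ B0 + A0 ⊗ₖ B1 + A1 ⊗ₖ B0 - A1 ⊗ₖ B1) := by
    have inv_sq : ((Real.sqrt 2 : ℝ) : ℂ)⁻¹ * ((Real.sqrt 2 : ℝ) : ℂ)⁻¹ = 1 / 2 := by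
      rw [← mul_inv, ← sq, sqrt_two_sq, one_div]
    have one_kronecker_squares :
        (1 : Matrix (Fin dA) (Fin dA) ℂ) ⊗ₖ ((B0 + B1) * (B0 + B1)) +
          (1 : Matrix (Fin dA) (Fin dA) ℂ) ⊗ₖ ((B0 - B1) * (B0 - B1)) = (4 : ℂ) • 1 := by
      rw [← Matrix.kronecker_add, add_mul_self_add_sub_mul_self, Matrix.kronecker_smul,
        Matrix.one_kronecker_one]
    have kronecker_sub : A1 ⊗ₖ (B0 - B1) = A1 ⊗ₖ B0 - A1 ⊗ₖ B1 := by
      ext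
      simp [mul_sub]
    rw [hS0, hS1, kronecker_one_sub_one_kronecker_mul_self,
      kronecker_one_sub_one_kronecker_mul_self, hA0sq, hA1sq]
    simp only [smul_mul_smul_comm, inv_sq, Matrix.kronecker_smul, Matrix.one_kronecker_one,
      Matrix.kronecker_add A0, kronecker_sub]
    linear_combination (norm := module) (1 / 2 : ℂ) • one_kronecker_squares
  rw [sum_squares, hΦ]
  push_cast
  match_scalars <;> field_simp <;> norm_num [sqrt_two_sq]
end

section
/- Norm bounds for ε-optimal CHSH strategies: let A₀, A₁ be self-adjoint d_A×d_A matrices with A₀² = A₁² = 1, B₀, B₁ self-adjoint d_B×d_B matrices with B₀² = B₁² = 1, Φ := (1/2)·1 + (1/8)(A₀⊗B₀ + A₀⊗B₁ + A₁⊗B₀ − A₁⊗B₁), and let ψ ∈ ℂ^{d_A}⊗ℂ^{d_B} be a unit vector with ⟨ψ, Φψ⟩ ≥ 1/2 + 1/(2√2) − ε for some ε ≥ 0. Then ‖(A₀⊗1 − 1⊗(B₀+B₁)/√2)ψ‖ ≤ 128^{1/4}·√ε and ‖(A₁⊗1 − 1⊗(B₀−B₁)/√2)ψ‖ ≤ 128^{1/4}·√ε.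 -/
open scoped Matrix Kronecker

/-- The Euclidean (ℓ²) norm of a finitely-indexed complex vector. -/
noncomputable def l2norm {ι : Type*} [Fintype ι] (v : ι → ℂ) : ℝ :=
  Real.sqrt (∑ i, Complex.normSq (v i))

/-- The squared `ℓ²` norm of `M ψ` for Hermitian `M` is the quadratic form of `M²`. -/
lemma sum_normSq_mulVec_of_isHermitian {ι : Type*} [Fintype ι] {M : Matrix ι ι ℂ}
    (hM : M.IsHermitian) (v : ι → ℂ) :
    ∑ i, Complex.normSq ((M *ᵥ v) i) = (star v ⬝ᵥ ((M * M) *ᵥ v)).re := by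
  have h : star v ⬝ᵥ ((M * M) *ᵥ v) = star (M *ᵥ v) ⬝ᵥ (M *ᵥ v) := by
    rw [Matrix.star_mulVec, hM.eq, ← Matrix.mulVec_mulVec, Matrix.dotProduct_mulVec]
  rw [h, dotProduct, Complex.re_sum]
  refine Finset.sum_congr rfl fun i _ => ?_
  simp [Complex.normSq_apply]

/-- The sum-of-squares decomposition of the CHSH operator in an algebra of commuting involutions. -/
lemma chsh_sum_of_squares {R : Type*} [Ring R] [Algebra ℂ R] {a₀ a₁ b₀ b₁ : R}
    (ha₀ : a₀ * a₀ = 1) (ha₁ : a₁ * a₁ = 1) (hb₀ : b₀ * b₀ = 1) (hb₁ : b₁ * b₁ = 1)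
    (h₀₀ : b₀ * a₀ = a₀ * b₀) (h₀₁ : b₁ * a₀ = a₀ * b₁)
    (h₁₀ : b₀ * a₁ = a₁ * b₀) (h₁₁ : b₁ * a₁ = a₁ * b₁) {s : ℂ} (hs : s * s = 1 / 2) :
    (a₀ - s • (b₀ + b₁)) * (a₀ - s • (b₀ + b₁)) + (a₁ - s • (b₀ - b₁)) * (a₁ - s • (b₀ - b₁)) =
      (4 : ℂ) • (1 : R) - (2 * s) • (a₀ * b₀ + a₀ * b₁ + a₁ * b₀ - a₁ * b₁) := by
  simp only [sub_mul, mul_sub, add_mul, mul_add, smul_add, smul_sub, smul_mul_assoc,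
    mul_smul_comm, smul_smul, hs, ha₀, ha₁, hb₀, hb₁, h₀₀, h₀₁, h₁₀, h₁₁]
  module

/-- **Norm bounds for ε-optimal CHSH strategies.** If a unit vector `ψ` achieves CHSH
value at least `½ + 1/(2√2) − ε`, then
`‖(A₀⊗1 − 1⊗(B₀+B₁)/√2)ψ‖ ≤ 128^{1/4}·√ε` and `‖(A₁⊗1 − 1⊗(B₀−B₁)/√2)ψ‖ ≤ 128^{1/4}·√ε`. -/
theorem chsh_eps_optimal_norm_bounds {dA dB : ℕ}
    (A0 A1 : Matrix (Fin dA) (Fin dA) ℂ) (B0 B1 : Matrix (Fin dB) (Fin dB) ℂ)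
    (hA0 : A0.IsHermitian) (hA1 : A1.IsHermitian)
    (hB0 : B0.IsHermitian) (hB1 : B1.IsHermitian)
    (hA0sq : A0 * A0 = 1) (hA1sq : A1 * A1 = 1)
    (hB0sq : B0 * B0 = 1) (hB1sq : B1 * B1 = 1)
    (Φ : Matrix (Fin dA × Fin dB) (Fin dA × Fin dB) ℂ)
    (hΦ : Φ = (1 / 2 : ℂ) • (1 : Matrix (Fin dA × Fin dB) (Fin dA × Fin dB) ℂ) +
      (1 / 8 : ℂ) • (A0 ⊗ₖ B0 + A0 ⊗ₖ B1 + A1 ⊗ₖ B0 - A1 ⊗ₖ B1))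
    (ψ : Fin dA × Fin dB → ℂ) (hψ : ∑ i, Complex.normSq (ψ i) = 1)
    (ε : ℝ) (hε : 0 ≤ ε)
    (hval : 1 / 2 + 1 / (2 * Real.sqrt 2) - ε ≤
      (∑ i, (starRingEnd ℂ) (ψ i) * (Φ *ᵥ ψ) i).re) :
    l2norm ((A0 ⊗ₖ (1 : Matrix (Fin dB) (Fin dB) ℂ) -
        (1 : Matrix (Fin dA) (Fin dA) ℂ) ⊗ₖ (((Real.sqrt 2 : ℝ) : ℂ)⁻¹ • (B0 + B1))) *ᵥ ψ) ≤
      (128 : ℝ) ^ ((1 : ℝ) / 4) * Real.sqrt ε ∧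
    l2norm ((A1 ⊗ₖ (1 : Matrix (Fin dB) (Fin dB) ℂ) -
        (1 : Matrix (Fin dA) (Fin dA) ℂ) ⊗ₖ (((Real.sqrt 2 : ℝ) : ℂ)⁻¹ • (B0 - B1))) *ᵥ ψ) ≤
      (128 : ℝ) ^ ((1 : ℝ) / 4) * Real.sqrt ε := by
  set r : ℝ := Real.sqrt 2 with hr
  have hr0 : 0 < r := by positivity
  have hr2 : r * r = 2 := Real.mul_self_sqrt (by norm_num)
  have hs : ((r : ℂ)⁻¹) * (r : ℂ)⁻¹ = 1 / 2 := by
    rw [← mul_inv, ← Complex.ofReal_mul, hr2]; norm_num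
  have hs2 : 2 * (r : ℂ)⁻¹ = r := by
    have : (r : ℂ) ≠ 0 := by exact_mod_cast hr0.ne'
    field_simp
    rw [sq, ← Complex.ofReal_mul, hr2]; norm_num
  set X := A0 ⊗ₖ (1 : Matrix (Fin dB) (Fin dB) ℂ) -
    (1 : Matrix (Fin dA) (Fin dA) ℂ) ⊗ₖ ((r : ℂ)⁻¹ • (B0 + B1)) with hX
  set Y := A1 ⊗ₖ (1 : Matrix (Fin dB) (Fin dB) ℂ) -
    (1 : Matrix (Fin dA) (Fin dA) ℂ) ⊗ₖ ((r : ℂ)⁻¹ • (B0 - B1)) with hY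
  have hXh : X.IsHermitian := by
    simp [hX, Matrix.IsHermitian, Matrix.conjTranspose_kronecker, hA0.eq, hB0.eq, hB1.eq]
  have hYh : Y.IsHermitian := by
    simp [hY, Matrix.IsHermitian, Matrix.conjTranspose_kronecker, hA1.eq, hB0.eq, hB1.eq]
  have hsos : X * X + Y * Y = ((4 + 4 * r : ℝ) : ℂ) • 1 - ((8 * r : ℝ) : ℂ) • Φ := by
    have key := chsh_sum_of_squares (R := Matrix (Fin dA × Fin dB) (Fin dA × Fin dB) ℂ)
      (a₀ := A0 ⊗ₖ 1) (a₁ := A1 ⊗ₖ 1) (b₀ := 1 ⊗ₖ B0) (b₁ := 1 ⊗ₖ B1)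
      (by simp [← Matrix.mul_kronecker_mul, hA0sq]) (by simp [← Matrix.mul_kronecker_mul, hA1sq])
      (by simp [← Matrix.mul_kronecker_mul, hB0sq]) (by simp [← Matrix.mul_kronecker_mul, hB1sq])
      (by simp [← Matrix.mul_kronecker_mul]) (by simp [← Matrix.mul_kronecker_mul])
      (by simp [← Matrix.mul_kronecker_mul]) (by simp [← Matrix.mul_kronecker_mul]) hs
    simp only [← Matrix.mul_kronecker_mul, mul_one, one_mul, hs2] at key
    rw [hX, hY, Matrix.kronecker_smul, Matrix.kronecker_smul, Matrix.kronecker_add,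
      sub_eq_add_neg B0 B1, Matrix.kronecker_add, ← neg_one_smul ℂ B1, Matrix.kronecker_smul,
      neg_one_smul, ← sub_eq_add_neg, key, hΦ]
    push_cast
    module
  have hψ' : star ψ ⬝ᵥ ψ = 1 := by
    rw [dotProduct, ← Complex.ofReal_one, ← hψ, Complex.ofReal_sum]
    refine Finset.sum_congr rfl fun i _ => ?_
    rw [Complex.normSq_eq_conj_mul_self]; rfl
  have hval' : 1 / 2 + 1 / (2 * r) - ε ≤ (star ψ ⬝ᵥ (Φ *ᵥ ψ)).re := hval
  have hsum : ∑ i, Complex.normSq ((X *ᵥ ψ) i) + ∑ i, Complex.normSq ((Y *ᵥ ψ) i) ≤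
      8 * r * ε := by
    rw [sum_normSq_mulVec_of_isHermitian hXh, sum_normSq_mulVec_of_isHermitian hYh,
      ← Complex.add_re, ← dotProduct_add, ← Matrix.add_mulVec, hsos, Matrix.sub_mulVec,
      Matrix.smul_mulVec, Matrix.smul_mulVec, Matrix.one_mulVec, dotProduct_sub,
      dotProduct_smul, dotProduct_smul, hψ', Complex.sub_re, smul_eq_mul, smul_eq_mul,
      Complex.re_ofReal_mul, Complex.re_ofReal_mul, Complex.one_re]
    have h1 := mul_le_mul_of_nonneg_left hval' (by positivity : 0 ≤ 8 * r)
    have h2 : 8 * r * (1 / 2 + 1 / (2 * r) - ε) = 4 * r + 4 - 8 * r * ε := by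
      field_simp
      ring
    linarith
  have hconst : (128 : ℝ) ^ ((1 : ℝ) / 4) * Real.sqrt ε = Real.sqrt (8 * r * ε) := by
    have h128 : (128 : ℝ) = (8 * r) ^ (2 : ℝ) := by
      rw [Real.rpow_two]; linear_combination (-64) * hr2
    rw [h128, ← Real.rpow_mul (by positivity), Real.sqrt_mul (by positivity),
      Real.sqrt_eq_rpow (8 * r)]
    norm_num
  have hXn : 0 ≤ ∑ i, Complex.normSq ((X *ᵥ ψ) i) :=
    Finset.sum_nonneg fun i _ => Complex.normSq_nonneg _
  have hYn : 0 ≤ ∑ i, Complex.normSq ((Y *ᵥ ψ) i) :=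
    Finset.sum_nonneg fun i _ => Complex.normSq_nonneg _
  rw [hconst]
  exact ⟨Real.sqrt_le_sqrt (by linarith), Real.sqrt_le_sqrt (by linarith)⟩
end

section
/- Approximate squaring-to-identity for ε-optimal CHSH strategies: under the hypotheses that A₀, A₁ are self-adjoint with A₀² = A₁² = 1, B₀, B₁ are self-adjoint with B₀² = B₁² = 1, Φ := (1/2)·1 + (1/8)(A₀⊗B₀ + A₀⊗B₁ + A₁⊗B₀ − A₁⊗B₁), and ψ is a unit vector with ⟨ψ, Φψ⟩ ≥ 1/2 + 1/(2√2) − ε, one has ‖ψ − (1⊗((B₀+B₁)/√2)²)ψ‖ ≤ (1+√2)·128^{1/4}·√ε and ‖ψ − (1⊗((B₀−B₁)/√2)²)ψ‖ ≤ (1+√2)·128^{1/4}·√ε. -/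
open scoped Matrix Kronecker

open scoped InnerProductSpace

theorem l2norm_eq_norm_toLp {ι : Type*} [Fintype ι] (v : ι → ℂ) :
    l2norm v = ‖WithLp.toLp 2 v‖ := by
  simp [l2norm, EuclideanSpace.norm_eq, Complex.normSq_eq_norm_sq]

theorem Matrix.IsHermitian.kronecker {m n : Type*} {A : Matrix m m ℂ} {B : Matrix n n ℂ}
    (hA : A.IsHermitian) (hB : B.IsHermitian) : (A ⊗ₖ B).IsHermitian := by
  rw [Matrix.IsHermitian, Matrix.conjTranspose_kronecker, hA.eq, hB.eq]

section Hilbert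

variable {E : Type*} [NormedAddCommGroup E] [InnerProductSpace ℂ E]

/-- The sum-of-squares identity behind Tsirelson's bound, on vectors. -/
theorem norm_sq_add_norm_sq_eq_of_norm_one {u₀ u₁ v₀ v₁ : E}
    (hu₀ : ‖u₀‖ = 1) (hu₁ : ‖u₁‖ = 1) (hv₀ : ‖v₀‖ = 1) (hv₁ : ‖v₁‖ = 1) :
    ‖u₀ - ((√2 : ℝ) : ℂ)⁻¹ • (v₀ + v₁)‖ ^ 2 + ‖u₁ - ((√2 : ℝ) : ℂ)⁻¹ • (v₀ - v₁)‖ ^ 2 =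
      4 - √2 * (⟪u₀, v₀⟫_ℂ + ⟪u₀, v₁⟫_ℂ + ⟪u₁, v₀⟫_ℂ - ⟪u₁, v₁⟫_ℂ).re := by
  have hr : (√2)⁻¹ = √2 / 2 := by
    rw [inv_eq_one_div, div_eq_div_iff (by positivity) two_ne_zero]
    norm_num
  have hs : √2 ^ 2 = 2 := Real.sq_sqrt zero_le_two
  have hpar := parallelogram_law_with_norm ℂ v₀ v₁
  rw [← Complex.ofReal_inv, hr, @norm_sub_sq ℂ, @norm_sub_sq ℂ, norm_smul, norm_smul,
    inner_smul_right, inner_smul_right, inner_add_right, inner_sub_right, hu₀, hu₁]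
  simp only [Complex.norm_real, Real.norm_eq_abs, mul_pow, sq_abs, div_pow, hs,
    RCLike.re_to_complex, Complex.re_ofReal_mul, Complex.add_re, Complex.sub_re]
  rw [hv₀, hv₁] at hpar
  linarith

variable [CompleteSpace E]

theorem norm_apply_of_isSelfAdjoint_of_mul_self {a : E →L[ℂ] E} (ha : IsSelfAdjoint a)
    (ha2 : a * a = 1) (v : E) : ‖a v‖ = ‖v‖ := by
  have h : ⟪a v, a v⟫_ℂ = ⟪v, v⟫_ℂ := by
    rw [ha.isSymmetric.apply_clm, ← mul_apply_eq_comp, ha2,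
      one_apply_eq_self]
  rw [inner_self_eq_norm_sq_to_K, inner_self_eq_norm_sq_to_K] at h
  have h' : ‖a v‖ ^ 2 = ‖v‖ ^ 2 := by exact_mod_cast h
  exact (sq_eq_sq₀ (norm_nonneg _) (norm_nonneg _)).1 h'

theorem norm_sub_apply_apply_le {a s : E →L[ℂ] E} (ha : IsSelfAdjoint a) (ha2 : a * a = 1)
    (has : Commute a s) {C : ℝ} (hs : ∀ v, ‖s v‖ ≤ C * ‖v‖) (x : E) :
    ‖x - s (s x)‖ ≤ (1 + C) * ‖a x - s x‖ := by
  have h1 : a (a x) = x := by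
    rw [← mul_apply_eq_comp, ha2, one_apply_eq_self]
  have h2 : a (s x) = s (a x) := by
    simpa only [mul_apply_eq_comp] using DFunLike.congr_fun has.eq x
  have h3 : x - s (s x) = a (a x - s x) + s (a x - s x) := by
    rw [map_sub, map_sub, h1, h2]
    abel
  calc ‖x - s (s x)‖ ≤ ‖a (a x - s x)‖ + ‖s (a x - s x)‖ := h3 ▸ norm_add_le _ _
    _ ≤ ‖a x - s x‖ + C * ‖a x - s x‖ :=
      add_le_add (norm_apply_of_isSelfAdjoint_of_mul_self ha ha2 _).le (hs _)
    _ = (1 + C) * ‖a x - s x‖ := by ring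

theorem norm_sub_sq_apply_le_of_chsh_value {a₀ a₁ b₀ b₁ : E →L[ℂ] E}
    (ha₀ : IsSelfAdjoint a₀) (ha₁ : IsSelfAdjoint a₁)
    (hb₀ : IsSelfAdjoint b₀) (hb₁ : IsSelfAdjoint b₁)
    (ha₀2 : a₀ * a₀ = 1) (ha₁2 : a₁ * a₁ = 1) (hb₀2 : b₀ * b₀ = 1) (hb₁2 : b₁ * b₁ = 1)
    (h00 : Commute a₀ b₀) (h01 : Commute a₀ b₁) {x : E} (hx : ‖x‖ = 1) {ε : ℝ} (hε : 0 ≤ ε)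
    (hval : 2 * √2 - 8 * ε ≤
      (⟪x, (a₀ * b₀ + a₀ * b₁ + a₁ * b₀ - a₁ * b₁) x⟫_ℂ).re) :
    ‖x - ((((√2 : ℝ) : ℂ)⁻¹ • (b₀ + b₁)) * (((√2 : ℝ) : ℂ)⁻¹ • (b₀ + b₁))) x‖ ≤
      (1 + √2) * (128 : ℝ) ^ ((1 : ℝ) / 4) * √ε := by
  have hs : √2 * √2 = 2 := Real.mul_self_sqrt zero_le_two
  have n₀ := norm_apply_of_isSelfAdjoint_of_mul_self hb₀ hb₀2
  have n₁ := norm_apply_of_isSelfAdjoint_of_mul_self hb₁ hb₁2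
  have hbound : ∀ v, ‖(((√2 : ℝ) : ℂ)⁻¹ • (b₀ + b₁)) v‖ ≤ √2 * ‖v‖ := fun v ↦ by
    have h := norm_add_le (b₀ v) (b₁ v)
    rw [n₀, n₁] at h
    rw [smul_apply, add_apply, norm_smul, norm_inv,
      Complex.norm_real, Real.norm_of_nonneg (Real.sqrt_nonneg 2), inv_mul_le_iff₀ (by positivity),
      ← mul_assoc, hs]
    linarith
  have hsos := norm_sq_add_norm_sq_eq_of_norm_one
    ((norm_apply_of_isSelfAdjoint_of_mul_self ha₀ ha₀2 x).trans hx)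
    ((norm_apply_of_isSelfAdjoint_of_mul_self ha₁ ha₁2 x).trans hx)
    ((n₀ x).trans hx) ((n₁ x).trans hx)
  have hinner : ⟪x, (a₀ * b₀ + a₀ * b₁ + a₁ * b₀ - a₁ * b₁) x⟫_ℂ =
      ⟪a₀ x, b₀ x⟫_ℂ + ⟪a₀ x, b₁ x⟫_ℂ + ⟪a₁ x, b₀ x⟫_ℂ - ⟪a₁ x, b₁ x⟫_ℂ := by
    simp only [ha₀.isSymmetric.apply_clm, ha₁.isSymmetric.apply_clm,
      sub_apply, add_apply, mul_apply_eq_comp,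
      inner_add_right, inner_sub_right]
  rw [hinner] at hval
  have hroot : ((128 : ℝ) ^ ((1 : ℝ) / 4) * √ε) ^ 2 = 8 * √2 * ε := by
    rw [mul_pow, Real.sq_sqrt hε, ← Real.rpow_natCast, ← Real.rpow_mul (by norm_num),
      show (1 : ℝ) / 4 * (2 : ℕ) = 1 / 2 by norm_num, ← Real.sqrt_eq_rpow,
      show (128 : ℝ) = 8 ^ 2 * 2 by norm_num, Real.sqrt_mul (by positivity),
      Real.sqrt_sq (by norm_num)]
  have hdist : ‖a₀ x - (((√2 : ℝ) : ℂ)⁻¹ • (b₀ + b₁)) x‖ ≤ (128 : ℝ) ^ ((1 : ℝ) / 4) * √ε := by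
    refine (sq_le_sq₀ (norm_nonneg _) (by positivity)).1 ?_
    rw [hroot, smul_apply, add_apply]
    have hmul := mul_le_mul_of_nonneg_left hval (Real.sqrt_nonneg 2)
    have hpos := sq_nonneg ‖a₁ x - ((√2 : ℝ) : ℂ)⁻¹ • (b₀ x - b₁ x)‖
    linear_combination hmul + hpos + hsos - 2 * hs
  rw [mul_assoc]
  exact (norm_sub_apply_apply_le ha₀ ha₀2 ((h00.add_right h01).smul_right _) hbound x).trans
    (mul_le_mul_of_nonneg_left hdist (by positivity))

end Hilbert

theorem l2norm_sub_kronecker_sq_mulVec_le {m n : Type*} [Fintype m] [Fintype n] [DecidableEq m]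
    [DecidableEq n] {A₀ A₁ : Matrix m m ℂ} {B₀ B₁ : Matrix n n ℂ}
    (hA₀ : A₀.IsHermitian) (hA₁ : A₁.IsHermitian)
    (hB₀ : B₀.IsHermitian) (hB₁ : B₁.IsHermitian)
    (hA₀2 : A₀ * A₀ = 1) (hA₁2 : A₁ * A₁ = 1) (hB₀2 : B₀ * B₀ = 1) (hB₁2 : B₁ * B₁ = 1)
    {ψ : m × n → ℂ} (hψ : ∑ i, Complex.normSq (ψ i) = 1) {ε : ℝ} (hε : 0 ≤ ε)
    (hval : 1 / 2 + 1 / (2 * √2) - ε ≤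
      (∑ i, (starRingEnd ℂ) (ψ i) * (((1 / 2 : ℂ) • (1 : Matrix (m × n) (m × n) ℂ) +
        (1 / 8 : ℂ) • (A₀ ⊗ₖ B₀ + A₀ ⊗ₖ B₁ + A₁ ⊗ₖ B₀ - A₁ ⊗ₖ B₁)) *ᵥ ψ) i).re) :
    l2norm (ψ - ((1 : Matrix m m ℂ) ⊗ₖ
        ((((√2 : ℝ) : ℂ)⁻¹ • (B₀ + B₁)) * (((√2 : ℝ) : ℂ)⁻¹ • (B₀ + B₁)))) *ᵥ ψ) ≤
      (1 + √2) * (128 : ℝ) ^ ((1 : ℝ) / 4) * √ε := by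
  let T := Matrix.toEuclideanCLM (n := m × n) (𝕜 := ℂ)
  let x := WithLp.toLp 2 ψ
  have hinv : ∀ {M : Matrix (m × n) (m × n) ℂ}, M * M = 1 → T M * T M = 1 := fun h ↦ by
    rw [← map_mul, h, map_one]
  have hsa : ∀ {M : Matrix (m × n) (m × n) ℂ}, M.IsHermitian → IsSelfAdjoint (T M) := fun h ↦
    IsSelfAdjoint.map h T
  have hmul : ∀ (A : Matrix m m ℂ) (B : Matrix n n ℂ),
      T (A ⊗ₖ 1) * T (1 ⊗ₖ B) = T (A ⊗ₖ B) := fun A B ↦ by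
    rw [← map_mul, ← Matrix.mul_kronecker_mul, mul_one, one_mul]
  have hcomm : ∀ (A : Matrix m m ℂ) (B : Matrix n n ℂ),
      Commute (T (A ⊗ₖ 1)) (T (1 ⊗ₖ B)) := fun A B ↦ by
    rw [Commute, SemiconjBy, hmul, ← map_mul, ← Matrix.mul_kronecker_mul, mul_one, one_mul]
  have hx : ‖x‖ = 1 := by rw [← l2norm_eq_norm_toLp, l2norm, hψ, Real.sqrt_one]
  have hsum : ∀ M : Matrix (m × n) (m × n) ℂ,
      ∑ i, (starRingEnd ℂ) (ψ i) * (M *ᵥ ψ) i = ⟪x, T M x⟫_ℂ := fun M ↦ by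
    simp [T, x, PiLp.inner_apply, mul_comm]
  have hx2 : ⟪x, x⟫_ℂ = 1 := by simp [inner_self_eq_norm_sq_to_K, hx]
  have key := norm_sub_sq_apply_le_of_chsh_value (E := EuclideanSpace ℂ (m × n))
    (a₀ := T (A₀ ⊗ₖ 1)) (a₁ := T (A₁ ⊗ₖ 1)) (b₀ := T (1 ⊗ₖ B₀)) (b₁ := T (1 ⊗ₖ B₁))
    (hsa (hA₀.kronecker Matrix.isHermitian_one)) (hsa (hA₁.kronecker Matrix.isHermitian_one))
    (hsa (Matrix.isHermitian_one.kronecker hB₀)) (hsa (Matrix.isHermitian_one.kronecker hB₁))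
    (hinv (by rw [← Matrix.mul_kronecker_mul, hA₀2, mul_one, Matrix.one_kronecker_one]))
    (hinv (by rw [← Matrix.mul_kronecker_mul, hA₁2, mul_one, Matrix.one_kronecker_one]))
    (hinv (by rw [← Matrix.mul_kronecker_mul, hB₀2, mul_one, Matrix.one_kronecker_one]))
    (hinv (by rw [← Matrix.mul_kronecker_mul, hB₁2, mul_one, Matrix.one_kronecker_one]))
    (hcomm A₀ B₀) (hcomm A₀ B₁) hx hε ?_
  · rw [← map_add, ← map_smul, ← map_mul, ← Matrix.kronecker_add, ← Matrix.kronecker_smul,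
      ← Matrix.mul_kronecker_mul, one_mul] at key
    rw [l2norm_eq_norm_toLp, WithLp.toLp_sub]
    exact key
  · rw [hsum, map_add, map_smul, map_smul, map_one, add_apply,
      smul_apply, smul_apply,
      one_apply_eq_self, inner_add_right, inner_smul_right, inner_smul_right, hx2,
      mul_one, Complex.add_re, show (1 / 8 : ℂ) = ((1 / 8 : ℝ) : ℂ) by norm_num,
      Complex.re_ofReal_mul, show (1 / 2 : ℂ).re = 1 / 2 by norm_num] at hval
    rw [hmul, hmul, hmul, hmul, ← map_add, ← map_add, ← map_sub]
    have hs : 1 / (2 * √2) = √2 / 4 := by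
      rw [div_eq_div_iff (by positivity) four_ne_zero]
      linear_combination -2 * Real.mul_self_sqrt (zero_le_two (α := ℝ))
    rw [hs] at hval
    linarith

/-- **Approximate squaring-to-identity for ε-optimal CHSH strategies.** If a unit vector
`ψ` achieves CHSH value at least `½ + 1/(2√2) − ε`, then
`‖ψ − (1⊗((B₀±B₁)/√2)²)ψ‖ ≤ (1+√2)·128^{1/4}·√ε`. -/
theorem chsh_eps_optimal_square_identity {dA dB : ℕ}
    (A0 A1 : Matrix (Fin dA) (Fin dA) ℂ) (B0 B1 : Matrix (Fin dB) (Fin dB) ℂ)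
    (hA0 : A0.IsHermitian) (hA1 : A1.IsHermitian)
    (hB0 : B0.IsHermitian) (hB1 : B1.IsHermitian)
    (hA0sq : A0 * A0 = 1) (hA1sq : A1 * A1 = 1)
    (hB0sq : B0 * B0 = 1) (hB1sq : B1 * B1 = 1)
    (Φ : Matrix (Fin dA × Fin dB) (Fin dA × Fin dB) ℂ)
    (hΦ : Φ = (1 / 2 : ℂ) • (1 : Matrix (Fin dA × Fin dB) (Fin dA × Fin dB) ℂ) +
      (1 / 8 : ℂ) • (A0 ⊗ₖ B0 + A0 ⊗ₖ B1 + A1 ⊗ₖ B0 - A1 ⊗ₖ B1))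
    (ψ : Fin dA × Fin dB → ℂ) (hψ : ∑ i, Complex.normSq (ψ i) = 1)
    (ε : ℝ) (hε : 0 ≤ ε)
    (hval : 1 / 2 + 1 / (2 * Real.sqrt 2) - ε ≤
      (∑ i, (starRingEnd ℂ) (ψ i) * (Φ *ᵥ ψ) i).re) :
    l2norm (ψ - ((1 : Matrix (Fin dA) (Fin dA) ℂ) ⊗ₖ
        ((((Real.sqrt 2 : ℝ) : ℂ)⁻¹ • (B0 + B1)) * (((Real.sqrt 2 : ℝ) : ℂ)⁻¹ • (B0 + B1)))) *ᵥ ψ) ≤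
      (1 + Real.sqrt 2) * (128 : ℝ) ^ ((1 : ℝ) / 4) * Real.sqrt ε ∧
    l2norm (ψ - ((1 : Matrix (Fin dA) (Fin dA) ℂ) ⊗ₖ
        ((((Real.sqrt 2 : ℝ) : ℂ)⁻¹ • (B0 - B1)) * (((Real.sqrt 2 : ℝ) : ℂ)⁻¹ • (B0 - B1)))) *ᵥ ψ) ≤
      (1 + Real.sqrt 2) * (128 : ℝ) ^ ((1 : ℝ) / 4) * Real.sqrt ε := by
  subst hΦ
  refine ⟨l2norm_sub_kronecker_sq_mulVec_le hA0 hA1 hB0 hB1 hA0sq hA1sq hB0sq hB1sq hψ hε hval, ?_⟩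
  have hswap : A1 ⊗ₖ B0 + A1 ⊗ₖ (-B1) + A0 ⊗ₖ B0 - A0 ⊗ₖ (-B1) =
      A0 ⊗ₖ B0 + A0 ⊗ₖ B1 + A1 ⊗ₖ B0 - A1 ⊗ₖ B1 := by
    ext i j
    simp only [Matrix.sub_apply, Matrix.add_apply, Matrix.kroneckerMap_apply, Matrix.neg_apply]
    ring
  rw [← hswap] at hval
  simpa only [sub_eq_add_neg] using l2norm_sub_kronecker_sq_mulVec_le hA1 hA0 hB0 hB1.neg
    hA1sq hA0sq hB0sq (by rw [neg_mul_neg, hB1sq]) hψ hε hval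
end

section
/- Approximate anticommutation of Bob's observables for ε-optimal CHSH strategies: under the hypotheses that A₀, A₁ are self-adjoint with A₀² = A₁² = 1, B₀, B₁ are self-adjoint with B₀² = B₁² = 1, Φ := (1/2)·1 + (1/8)(A₀⊗B₀ + A₀⊗B₁ + A₁⊗B₀ − A₁⊗B₁), and ψ is a unit vector with ⟨ψ, Φψ⟩ ≥ 1/2 + 1/(2√2) − ε, one has ‖(1⊗(B₀B₁ + B₁B₀))ψ‖ ≤ 2(1+√2)·128^{1/4}·√ε. -/
open scoped Matrix Kronecker

section

variable {E : Type*} [NormedAddCommGroup E] [InnerProductSpace ℂ E]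

/-- The vector form of Tsirelson's sum-of-squares identity. -/
theorem tsirelson_sum_of_squares {w x y z : E}
    (hw : ‖w‖ = 1) (hx : ‖x‖ = 1) (hy : ‖y‖ = 1) (hz : ‖z‖ = 1) :
    ‖y + z - ((√2 : ℝ) : ℂ) • w‖ ^ 2 + ‖y - z - ((√2 : ℝ) : ℂ) • x‖ ^ 2 =
      8 - 2 * √2 * (inner ℂ w y + inner ℂ w z + inner ℂ x y - inner ℂ x z).re := by
  have h2 : √2 ^ 2 = 2 := Real.sq_sqrt zero_le_two
  have hpar := parallelogram_law_with_norm ℂ y z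
  have hn (v : E) : ‖((√2 : ℝ) : ℂ) • v‖ = √2 * ‖v‖ := by
    rw [norm_smul, Complex.norm_real, Real.norm_of_nonneg (Real.sqrt_nonneg 2)]
  rw [norm_sub_sq (𝕜 := ℂ), norm_sub_sq (𝕜 := ℂ), hn, hn, inner_re_symm, inner_re_symm (y - z),
    inner_smul_left, inner_smul_left, Complex.conj_ofReal, inner_add_right, inner_sub_right]
  simp only [RCLike.re_eq_complex_re, Complex.re_ofReal_mul, Complex.add_re, Complex.sub_re, hw, hx]
  rw [hy, hz] at hpar
  linear_combination hpar + 2 * h2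

/-- A symmetric involution is an isometry. -/
theorem LinearMap.IsSymmetric.norm_map_of_mul_self {T : E →ₗ[ℂ] E} (hT : T.IsSymmetric)
    (hsq : T * T = 1) (v : E) : ‖T v‖ = ‖v‖ := by
  have h : inner ℂ (T v) (T v) = inner ℂ v v := by
    rw [hT v (T v), ← Module.End.mul_apply, hsq, Module.End.one_apply]
  rw [norm_eq_sqrt_re_inner (𝕜 := ℂ), h, ← norm_eq_sqrt_re_inner]

/-- If `b₀ + b₁` acts on `ψ` almost as `√2 a`, where `a` commutes with `b₀` and `b₁`,
then `b₀` and `b₁` almost anticommute on `ψ`. -/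
theorem norm_anticommutator_apply_le {a b₀ b₁ : E →ₗ[ℂ] E}
    (ha : a.IsSymmetric) (hb₀ : b₀.IsSymmetric) (hb₁ : b₁.IsSymmetric)
    (ha2 : a * a = 1) (hb₀2 : b₀ * b₀ = 1) (hb₁2 : b₁ * b₁ = 1)
    (hab₀ : Commute a b₀) (hab₁ : Commute a b₁) (ψ : E) :
    ‖(b₀ * b₁ + b₁ * b₀) ψ‖ ≤
      (2 + √2) * ‖b₀ ψ + b₁ ψ - ((√2 : ℝ) : ℂ) • a ψ‖ := by
  set u := b₀ ψ + b₁ ψ - ((√2 : ℝ) : ℂ) • a ψ with hu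
  have e (T S : E →ₗ[ℂ] E) (h : T * S = 1) : T (S ψ) = ψ := by
    rw [← Module.End.mul_apply, h, Module.End.one_apply]
  have c (T S : E →ₗ[ℂ] E) (h : Commute T S) : T (S ψ) = S (T ψ) := by
    rw [← Module.End.mul_apply, h.eq, Module.End.mul_apply]
  have h2 : ((√2 : ℝ) : ℂ) * ((√2 : ℝ) : ℂ) = 2 := by
    rw [← Complex.ofReal_mul, Real.mul_self_sqrt zero_le_two, Complex.ofReal_ofNat]
  have key : (b₀ * b₁ + b₁ * b₀) ψ = b₀ u + b₁ u + ((√2 : ℝ) : ℂ) • a u := by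
    simp only [hu, LinearMap.add_apply, Module.End.mul_apply, map_add, map_sub, map_smul,
      e _ _ ha2, e _ _ hb₀2, e _ _ hb₁2, c _ _ hab₀, c _ _ hab₁, smul_sub, smul_add, smul_smul, h2]
    module
  calc ‖(b₀ * b₁ + b₁ * b₀) ψ‖ ≤ ‖b₀ u‖ + ‖b₁ u‖ + ‖((√2 : ℝ) : ℂ) • a u‖ :=
        key ▸ norm_add₃_le
    _ = (2 + √2) * ‖u‖ := by
        rw [norm_smul, Complex.norm_real, Real.norm_of_nonneg (Real.sqrt_nonneg 2),
          ha.norm_map_of_mul_self ha2, hb₀.norm_map_of_mul_self hb₀2,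
          hb₁.norm_map_of_mul_self hb₁2]
        ring

/-- Approximate anticommutation for commuting pairs of symmetric involutions whose CHSH
correlation is within `8ε` of the Tsirelson bound. -/
theorem norm_anticommutator_apply_le_of_chsh {a₀ a₁ b₀ b₁ : E →ₗ[ℂ] E}
    (ha₀ : a₀.IsSymmetric) (ha₁ : a₁.IsSymmetric) (hb₀ : b₀.IsSymmetric) (hb₁ : b₁.IsSymmetric)
    (ha₀2 : a₀ * a₀ = 1) (ha₁2 : a₁ * a₁ = 1) (hb₀2 : b₀ * b₀ = 1) (hb₁2 : b₁ * b₁ = 1)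
    (h₀₀ : Commute a₀ b₀) (h₀₁ : Commute a₀ b₁) {ψ : E} (hψ : ‖ψ‖ = 1) {ε : ℝ} (hε : 0 ≤ ε)
    (hval : 2 * √2 - 8 * ε ≤
      (inner ℂ ψ ((a₀ * b₀ + a₀ * b₁ + a₁ * b₀ - a₁ * b₁) ψ)).re) :
    ‖(b₀ * b₁ + b₁ * b₀) ψ‖ ≤ 2 * (1 + √2) * (128 : ℝ) ^ ((1 : ℝ) / 4) * √ε := by
  have h2 : √2 ^ 2 = 2 := Real.sq_sqrt zero_le_two
  have hr : (128 : ℝ) ^ ((1 : ℝ) / 4) = √(8 * √2) := by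
    rw [show (128 : ℝ) = (8 * √2) ^ (2 : ℝ) by rw [Real.rpow_two, mul_pow, h2]; norm_num,
      ← Real.rpow_mul (by positivity), Real.sqrt_eq_rpow (8 * √2)]
    congr 1
    norm_num
  have hsos := tsirelson_sum_of_squares
    ((ha₀.norm_map_of_mul_self ha₀2 ψ).trans hψ) ((ha₁.norm_map_of_mul_self ha₁2 ψ).trans hψ)
    ((hb₀.norm_map_of_mul_self hb₀2 ψ).trans hψ) ((hb₁.norm_map_of_mul_self hb₁2 ψ).trans hψ)
  simp only [LinearMap.add_apply, LinearMap.sub_apply, Module.End.mul_apply, inner_add_right,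
    inner_sub_right, ← ha₀ ψ, ← ha₁ ψ] at hval
  set u := b₀ ψ + b₁ ψ - ((√2 : ℝ) : ℂ) • a₀ ψ
  have hu : ‖u‖ ≤ √2 * √(8 * √2) * √ε := by
    refine le_of_sq_le_sq ?_ (by positivity)
    rw [mul_pow, mul_pow, h2, Real.sq_sqrt (by positivity), Real.sq_sqrt hε]
    have := mul_le_mul_of_nonneg_left hval (by positivity : 0 ≤ 2 * √2)
    nlinarith [sq_nonneg ‖b₀ ψ - b₁ ψ - ((√2 : ℝ) : ℂ) • a₁ ψ‖]
  calc ‖(b₀ * b₁ + b₁ * b₀) ψ‖ ≤ (2 + √2) * ‖u‖ :=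
        norm_anticommutator_apply_le ha₀ hb₀ hb₁ ha₀2 hb₀2 hb₁2 h₀₀ h₀₁ ψ
    _ ≤ (2 + √2) * (√2 * √(8 * √2) * √ε) := by gcongr
    _ = 2 * (1 + √2) * (128 : ℝ) ^ ((1 : ℝ) / 4) * √ε := by
        rw [hr]
        linear_combination √(8 * √2) * √ε * h2

end

theorem norm_toLp_eq_l2norm {ι : Type*} [Fintype ι] (v : ι → ℂ) :
    ‖WithLp.toLp 2 v‖ = l2norm v := by
  simp [EuclideanSpace.norm_eq, l2norm, Complex.normSq_eq_norm_sq]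

/-- **Approximate anticommutation of Bob's observables for ε-optimal CHSH strategies.**
If a unit vector `ψ` achieves CHSH value at least `½ + 1/(2√2) − ε`, then
`‖(1⊗(B₀B₁ + B₁B₀))ψ‖ ≤ 2(1+√2)·128^{1/4}·√ε`. -/
theorem chsh_eps_optimal_anticommutation {dA dB : ℕ}
    (A0 A1 : Matrix (Fin dA) (Fin dA) ℂ) (B0 B1 : Matrix (Fin dB) (Fin dB) ℂ)
    (hA0 : A0.IsHermitian) (hA1 : A1.IsHermitian)
    (hB0 : B0.IsHermitian) (hB1 : B1.IsHermitian)
    (hA0sq : A0 * A0 = 1) (hA1sq : A1 * A1 = 1)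
    (hB0sq : B0 * B0 = 1) (hB1sq : B1 * B1 = 1)
    (Φ : Matrix (Fin dA × Fin dB) (Fin dA × Fin dB) ℂ)
    (hΦ : Φ = (1 / 2 : ℂ) • (1 : Matrix (Fin dA × Fin dB) (Fin dA × Fin dB) ℂ) +
      (1 / 8 : ℂ) • (A0 ⊗ₖ B0 + A0 ⊗ₖ B1 + A1 ⊗ₖ B0 - A1 ⊗ₖ B1))
    (ψ : Fin dA × Fin dB → ℂ) (hψ : ∑ i, Complex.normSq (ψ i) = 1)
    (ε : ℝ) (hε : 0 ≤ ε)
    (hval : 1 / 2 + 1 / (2 * Real.sqrt 2) - ε ≤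
      (∑ i, (starRingEnd ℂ) (ψ i) * (Φ *ᵥ ψ) i).re) :
    l2norm (((1 : Matrix (Fin dA) (Fin dA) ℂ) ⊗ₖ (B0 * B1 + B1 * B0)) *ᵥ ψ) ≤
      2 * (1 + Real.sqrt 2) * (128 : ℝ) ^ ((1 : ℝ) / 4) * Real.sqrt ε := by
  have hmul (M N : Matrix (Fin dA × Fin dB) (Fin dA × Fin dB) ℂ) :
      Matrix.toEuclideanLin (M * N) = Matrix.toEuclideanLin M * Matrix.toEuclideanLin N := by
    ext v : 1
    simp [Matrix.toLpLin_apply]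
  have hone : Matrix.toEuclideanLin (1 : Matrix (Fin dA × Fin dB) (Fin dA × Fin dB) ℂ) = 1 := by
    ext v : 1
    simp
  have hsymm {M : Matrix (Fin dA × Fin dB) (Fin dA × Fin dB) ℂ} (hM : M.IsHermitian) :
      (Matrix.toEuclideanLin M).IsSymmetric := Matrix.isSymmetric_toEuclideanLin_iff.mpr hM
  have hA {M : Matrix (Fin dA) (Fin dA) ℂ} (hM : M.IsHermitian) :
      (M ⊗ₖ (1 : Matrix (Fin dB) (Fin dB) ℂ)).IsHermitian := by
    rw [Matrix.IsHermitian, Matrix.conjTranspose_kronecker, hM.eq, Matrix.conjTranspose_one]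
  have hB {M : Matrix (Fin dB) (Fin dB) ℂ} (hM : M.IsHermitian) :
      ((1 : Matrix (Fin dA) (Fin dA) ℂ) ⊗ₖ M).IsHermitian := by
    rw [Matrix.IsHermitian, Matrix.conjTranspose_kronecker, hM.eq, Matrix.conjTranspose_one]
  have hA2 {M : Matrix (Fin dA) (Fin dA) ℂ} (hM : M * M = 1) :
      Matrix.toEuclideanLin (M ⊗ₖ (1 : Matrix (Fin dB) (Fin dB) ℂ)) *
        Matrix.toEuclideanLin (M ⊗ₖ (1 : Matrix (Fin dB) (Fin dB) ℂ)) = 1 := by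
    rw [← hmul, ← Matrix.mul_kronecker_mul, hM, one_mul, Matrix.one_kronecker_one, hone]
  have hB2 {M : Matrix (Fin dB) (Fin dB) ℂ} (hM : M * M = 1) :
      Matrix.toEuclideanLin ((1 : Matrix (Fin dA) (Fin dA) ℂ) ⊗ₖ M) *
        Matrix.toEuclideanLin ((1 : Matrix (Fin dA) (Fin dA) ℂ) ⊗ₖ M) = 1 := by
    rw [← hmul, ← Matrix.mul_kronecker_mul, hM, one_mul, Matrix.one_kronecker_one, hone]
  have hAB (M : Matrix (Fin dA) (Fin dA) ℂ) (N : Matrix (Fin dB) (Fin dB) ℂ) :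
      Matrix.toEuclideanLin (M ⊗ₖ (1 : Matrix (Fin dB) (Fin dB) ℂ)) *
        Matrix.toEuclideanLin ((1 : Matrix (Fin dA) (Fin dA) ℂ) ⊗ₖ N) =
          Matrix.toEuclideanLin (M ⊗ₖ N) := by
    rw [← hmul, ← Matrix.mul_kronecker_mul, mul_one, one_mul]
  have hcomm (M : Matrix (Fin dA) (Fin dA) ℂ) (N : Matrix (Fin dB) (Fin dB) ℂ) :
      Commute (Matrix.toEuclideanLin (M ⊗ₖ (1 : Matrix (Fin dB) (Fin dB) ℂ)))
        (Matrix.toEuclideanLin ((1 : Matrix (Fin dA) (Fin dA) ℂ) ⊗ₖ N)) := by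
    rw [Commute, SemiconjBy, hAB, ← hmul, ← Matrix.mul_kronecker_mul, mul_one, one_mul]
  have hinner (M : Matrix (Fin dA × Fin dB) (Fin dA × Fin dB) ℂ) :
      inner ℂ (WithLp.toLp 2 ψ) (Matrix.toEuclideanLin M (WithLp.toLp 2 ψ)) =
        ∑ i, (starRingEnd ℂ) (ψ i) * (M *ᵥ ψ) i := by
    simp [PiLp.inner_apply, mul_comm]
  have hnorm : ‖WithLp.toLp 2 ψ‖ = 1 := by
    rw [norm_toLp_eq_l2norm, l2norm, hψ, Real.sqrt_one]
  have hbob : Matrix.toEuclideanLin ((1 : Matrix (Fin dA) (Fin dA) ℂ) ⊗ₖ (B0 * B1 + B1 * B0)) =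
      Matrix.toEuclideanLin ((1 : Matrix (Fin dA) (Fin dA) ℂ) ⊗ₖ B0) *
        Matrix.toEuclideanLin ((1 : Matrix (Fin dA) (Fin dA) ℂ) ⊗ₖ B1) +
      Matrix.toEuclideanLin ((1 : Matrix (Fin dA) (Fin dA) ℂ) ⊗ₖ B1) *
        Matrix.toEuclideanLin ((1 : Matrix (Fin dA) (Fin dA) ℂ) ⊗ₖ B0) := by
    rw [← hmul, ← hmul, ← Matrix.mul_kronecker_mul, ← Matrix.mul_kronecker_mul, one_mul,
      Matrix.kronecker_add, map_add]
  rw [← norm_toLp_eq_l2norm]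
  change ‖Matrix.toEuclideanLin ((1 : Matrix (Fin dA) (Fin dA) ℂ) ⊗ₖ (B0 * B1 + B1 * B0))
    (WithLp.toLp 2 ψ)‖ ≤ _
  rw [hbob]
  refine norm_anticommutator_apply_le_of_chsh (hsymm (hA hA0)) (hsymm (hA hA1)) (hsymm (hB hB0))
    (hsymm (hB hB1)) (hA2 hA0sq) (hA2 hA1sq) (hB2 hB0sq) (hB2 hB1sq) (hcomm A0 B0) (hcomm A0 B1)
    hnorm hε ?_
  have h2 : (1 / 2 : ℂ).re = 1 / 2 := by norm_num
  have h8 (z : ℂ) : (1 / 8 * z).re = 1 / 8 * z.re := by simp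
  have hs : 1 / (2 * √2) = √2 / 4 := by
    field_simp
    norm_num
  rw [hAB, hAB, hAB, hAB, ← map_add, ← map_add, ← map_sub]
  rw [← hinner, hΦ, map_add, map_smul, map_smul, hone, LinearMap.add_apply, LinearMap.smul_apply,
    LinearMap.smul_apply, Module.End.one_apply, inner_add_right, inner_smul_right,
    inner_smul_right, inner_self_eq_one_of_norm_eq_one hnorm, mul_one, Complex.add_re, h2, h8,
    hs] at hval
  linarith
end

section
/- Intermediate dilation estimate (the 3ε bound): let I_A : ℂ^{d_A} → ℂ^{d_Ã} ⊗ ℂ^{d_auxA} and I_F : ℂ^{d_F} → ℂ^{d_F̃} ⊗ ℂ^{d_auxF} be isometries, let ψ ∈ ℂ^{d_A} ⊗ ℂ^{d_F} and φ ∈ ℂ^{d_Ã} ⊗ ℂ^{d_F̃} be unit vectors, let aux ∈ ℂ^{d_auxA} ⊗ ℂ^{d_auxF} be a unit vector, and let M be a matrix on ℂ^{d_A} with ‖M‖ ≤ 1 and M̃ a matrix on ℂ^{d_Ã} with ‖M̃‖ ≤ 1. Assume (with tensor factors appropriately reordered) that ‖(I_A ⊗ I_F)(M ⊗ 1_F)ψ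 − ((M̃ ⊗ 1_F̃)φ) ⊗ aux‖ ≤ ε and ‖(I_A ⊗ I_F)ψ − φ ⊗ aux‖ ≤ ε. Then ‖((M − I_A†(M̃ ⊗ 1_auxA)I_A) ⊗ 1_F)ψ‖ ≤ 3ε. -/
open scoped Matrix Kronecker

/-- The tensor product of two vectors. -/
def tensorVec {ι κ : Type*} (u : ι → ℂ) (v : κ → ℂ) : ι × κ → ℂ :=
  fun p => u p.1 * v p.2

/-- Reordering of tensor factors `(α ⊗ β) ⊗ (γ ⊗ δ) → (α ⊗ γ) ⊗ (β ⊗ δ)` on vectors. -/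
def reorderVec {α β γ δ : Type*} (v : (α × β) × (γ × δ) → ℂ) :
    (α × γ) × (β × δ) → ℂ :=
  fun p => v ((p.1.1, p.2.1), (p.1.2, p.2.2))

theorem l2norm_eq_norm {ι : Type*} [Fintype ι] (v : ι → ℂ) :
    l2norm v = ‖(WithLp.toLp 2 v : EuclideanSpace ℂ ι)‖ := by
  simp [l2norm, EuclideanSpace.norm_eq, Complex.normSq_eq_norm_sq]

theorem l2norm_add_le {ι : Type*} [Fintype ι] (u v : ι → ℂ) :
    l2norm (u + v) ≤ l2norm u + l2norm v := by
  simpa only [l2norm_eq_norm, WithLp.toLp_add] using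
    norm_add_le (WithLp.toLp 2 u : EuclideanSpace ℂ ι) (WithLp.toLp 2 v)

theorem l2norm_sub_comm {ι : Type*} [Fintype ι] (u v : ι → ℂ) :
    l2norm (u - v) = l2norm (v - u) := by
  simpa only [l2norm_eq_norm, WithLp.toLp_sub] using
    norm_sub_rev (WithLp.toLp 2 u : EuclideanSpace ℂ ι) (WithLp.toLp 2 v)

open scoped Matrix.Norms.L2Operator in
theorem l2norm_mulVec_le {m n : Type*} [Fintype m] [Fintype n] [DecidableEq n]
    (A : Matrix m n ℂ) (v : n → ℂ) : l2norm (A *ᵥ v) ≤ ‖A‖ * l2norm v := by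
  rw [l2norm_eq_norm, l2norm_eq_norm]
  exact Matrix.l2_opNorm_mulVec A (WithLp.toLp 2 v)

theorem l2norm_conjTranspose_mulVec_le {m n : Type*} [Fintype m] [Fintype n] [DecidableEq m]
    [DecidableEq n] {V : Matrix m n ℂ} (hV : Vᴴ * V = 1) (w : m → ℂ) :
    l2norm (Vᴴ *ᵥ w) ≤ l2norm w := by
  open scoped Matrix.Norms.L2Operator in
  have hnorm : ‖Vᴴ‖ ≤ 1 := by
    have h := Matrix.l2_opNorm_conjTranspose_mul_self V
    have h1 : ‖(1 : Matrix n n ℂ)‖ ≤ 1 := by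
      rw [Matrix.cstar_norm_def, map_one]
      exact ContinuousLinearMap.norm_id_le
    rw [Matrix.l2_opNorm_conjTranspose]
    rw [hV] at h
    nlinarith [norm_nonneg V]
  exact (l2norm_mulVec_le Vᴴ w).trans (mul_le_of_le_one_left (Real.sqrt_nonneg _) hnorm)

/-- Tensoring a contraction with an identity gives a contraction. -/
theorem l2norm_kronecker_one_mulVec_le {n κ : Type*} [Fintype n] [Fintype κ] [DecidableEq κ]
    {A : Matrix n n ℂ} (hA : ∀ v, l2norm (A *ᵥ v) ≤ l2norm v) (v : n × κ → ℂ) :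
    l2norm ((A ⊗ₖ (1 : Matrix κ κ ℂ)) *ᵥ v) ≤ l2norm v := by
  have hslice (i : n) (k : κ) :
      ((A ⊗ₖ (1 : Matrix κ κ ℂ)) *ᵥ v) (i, k) = (A *ᵥ fun j => v (j, k)) i := by
    simp [Matrix.mulVec, dotProduct, Fintype.sum_prod_type, Matrix.one_apply]
  refine Real.sqrt_le_sqrt ?_
  rw [Fintype.sum_prod_type_right, Fintype.sum_prod_type_right]
  refine Finset.sum_le_sum fun k _ => ?_
  simp only [hslice]
  exact (Real.sqrt_le_sqrt_iff (Finset.sum_nonneg fun _ _ => Complex.normSq_nonneg _)).1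
    (hA fun j => v (j, k))

/-- An operator acting on the first factor commutes with appending an auxiliary state. -/
theorem kronecker_one_mulVec_reorderVec_tensorVec {α β γ δ : Type*} [Fintype α] [Fintype β]
    [Fintype γ] [Fintype δ] [DecidableEq β] [DecidableEq γ] [DecidableEq δ]
    (A : Matrix α α ℂ) (u : α × β → ℂ) (w : γ × δ → ℂ) :
    ((A ⊗ₖ (1 : Matrix γ γ ℂ)) ⊗ₖ (1 : Matrix (β × δ) (β × δ) ℂ)) *ᵥ
        reorderVec (tensorVec u w) =
      reorderVec (tensorVec ((A ⊗ₖ (1 : Matrix β β ℂ)) *ᵥ u) w) := by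
  ext ⟨⟨a, c⟩, ⟨b, d⟩⟩
  simp [Matrix.mulVec, dotProduct, reorderVec, tensorVec, Fintype.sum_prod_type,
    Matrix.one_apply, Finset.sum_mul, mul_assoc]

/-- **Intermediate dilation estimate (the 3ε bound).** If `(I_A ⊗ I_F)` ε-intertwines
`(M ⊗ 1)ψ` with `((M̃ ⊗ 1)φ) ⊗ aux` and `ψ` with `φ ⊗ aux`, then
`‖((M − I_A†(M̃ ⊗ 1_auxA)I_A) ⊗ 1_F)ψ‖ ≤ 3ε`. -/
theorem dilation_three_eps_bound {dA dF dAt dFt dauxA dauxF : ℕ}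
    (IA : Matrix (Fin dAt × Fin dauxA) (Fin dA) ℂ) (hIA : IAᴴ * IA = 1)
    (IF : Matrix (Fin dFt × Fin dauxF) (Fin dF) ℂ) (hIF : IFᴴ * IF = 1)
    (ψ : Fin dA × Fin dF → ℂ) (hψ : ∑ i, Complex.normSq (ψ i) = 1)
    (φ : Fin dAt × Fin dFt → ℂ) (hφ : ∑ i, Complex.normSq (φ i) = 1)
    (aux : Fin dauxA × Fin dauxF → ℂ) (haux : ∑ i, Complex.normSq (aux i) = 1)
    (M : Matrix (Fin dA) (Fin dA) ℂ) (hM : opNorm M ≤ 1)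
    (Mt : Matrix (Fin dAt) (Fin dAt) ℂ) (hMt : opNorm Mt ≤ 1)
    (ε : ℝ) (hε : 0 ≤ ε)
    (h1 : l2norm ((IA ⊗ₖ IF) *ᵥ ((M ⊗ₖ (1 : Matrix (Fin dF) (Fin dF) ℂ)) *ᵥ ψ) -
      reorderVec (tensorVec ((Mt ⊗ₖ (1 : Matrix (Fin dFt) (Fin dFt) ℂ)) *ᵥ φ) aux)) ≤ ε)
    (h2 : l2norm ((IA ⊗ₖ IF) *ᵥ ψ - reorderVec (tensorVec φ aux)) ≤ ε) :
    l2norm (((M - IAᴴ * (Mt ⊗ₖ (1 : Matrix (Fin dauxA) (Fin dauxA) ℂ)) * IA) ⊗ₖ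
      (1 : Matrix (Fin dF) (Fin dF) ℂ)) *ᵥ ψ) ≤ 3 * ε := by
  set V := IA ⊗ₖ IF with hVdef
  set T := (Mt ⊗ₖ (1 : Matrix (Fin dauxA) (Fin dauxA) ℂ)) ⊗ₖ
    (1 : Matrix (Fin dFt × Fin dauxF) (Fin dFt × Fin dauxF) ℂ) with hTdef
  have hV : Vᴴ * V = 1 := by
    rw [hVdef, Matrix.conjTranspose_kronecker, ← Matrix.mul_kronecker_mul, hIA, hIF,
      Matrix.one_kronecker_one]
  have hVTV : Vᴴ * T * V =
      (IAᴴ * (Mt ⊗ₖ (1 : Matrix (Fin dauxA) (Fin dauxA) ℂ)) * IA) ⊗ₖ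
        (1 : Matrix (Fin dF) (Fin dF) ℂ) := by
    rw [hVdef, hTdef, Matrix.conjTranspose_kronecker, ← Matrix.mul_kronecker_mul,
      ← Matrix.mul_kronecker_mul, Matrix.mul_one, hIF]
  have hMt' (v : Fin dAt → ℂ) : l2norm (Mt *ᵥ v) ≤ l2norm v :=
    (l2norm_mulVec_le Mt v).trans (mul_le_of_le_one_left (Real.sqrt_nonneg _) hMt)
  have hT (v) : l2norm (T *ᵥ v) ≤ l2norm v :=
    l2norm_kronecker_one_mulVec_le (l2norm_kronecker_one_mulVec_le hMt') v
  have hsplit : ((M - IAᴴ * (Mt ⊗ₖ (1 : Matrix (Fin dauxA) (Fin dauxA) ℂ)) * IA) ⊗ₖ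
      (1 : Matrix (Fin dF) (Fin dF) ℂ)) *ᵥ ψ =
      Vᴴ *ᵥ ((V *ᵥ ((M ⊗ₖ (1 : Matrix (Fin dF) (Fin dF) ℂ)) *ᵥ ψ) -
        reorderVec (tensorVec ((Mt ⊗ₖ (1 : Matrix (Fin dFt) (Fin dFt) ℂ)) *ᵥ φ) aux)) +
        T *ᵥ (reorderVec (tensorVec φ aux) - V *ᵥ ψ)) := by
    rw [Matrix.mulVec_sub, kronecker_one_mulVec_reorderVec_tensorVec, sub_add_sub_cancel,
      Matrix.mulVec_sub, Matrix.mulVec_mulVec, hV, Matrix.one_mulVec, Matrix.mulVec_mulVec,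
      Matrix.mulVec_mulVec, hVTV, ← Matrix.sub_mulVec]
    congr 1
    ext i j
    simp [sub_mul]
  rw [hsplit]
  refine (l2norm_conjTranspose_mulVec_le hV _).trans ((l2norm_add_le _ _).trans ?_)
  have h3 := hT (reorderVec (tensorVec φ aux) - V *ᵥ ψ)
  rw [l2norm_sub_comm (reorderVec _)] at h3
  linarith
end
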